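/- For all integers n ≥ 3 and s ≥ 3, the chi-square distance from the state e_n satisfies χ²_{e_n}(s) ≤ Σ_{k=1}^{∞} (32k³ + 16k² + 6k + 1) · β_k^{2s}, where β_k = C(2k,k)²/16^k and the series on the right converges. -/

import Mathlib

open Finset

attribute [local instance] Classical.propDecidable

/-- Stationary distribution of the binary Burnside process. -/
noncomputable def piDist (n : ℕ) (U : Finset ℕ) : ℝ :=
  1 / ((n + 1) * (n.choose U.card))

/-- Binary Burnside transition matrix entry. -/
noncomputable def Kmat (n : ℕ) (x y : Finset ℕ) : ℝ :=
  (((2 * (n - (x ∪ y).card)).choose (n - (x ∪ y).card) : ℝ) *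
      ((2 * ((y \ x).card)).choose ((y \ x).card)) *
      ((2 * ((x \ y).card)).choose ((x \ y).card)) *
      ((2 * ((x ∩ y).card)).choose ((x ∩ y).card))) /
    (4 ^ n * (((n - (x ∪ y).card) + (y \ x).card).choose (n - (x ∪ y).card)) *
      (((x \ y).card + (x ∩ y).card).choose ((x \ y).card)))

/-- Action of K_n on functions. -/
noncomputable def Kop (n : ℕ) (f : Finset ℕ → ℝ) : Finset ℕ → ℝ :=
  fun x => ∑ y ∈ (Finset.Icc 1 n).powerset, Kmat n x y * f y

/-- s-step transition probabilities. -/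
noncomputable def Kpow (n : ℕ) : ℕ → Finset ℕ → Finset ℕ → ℝ
  | 0 => fun x y => if x = y then 1 else 0
  | s + 1 => fun x y => ∑ z ∈ (Finset.Icc 1 n).powerset, Kmat n x z * Kpow n s z y

/-- Chi-square distance to stationarity after s steps, started at x. -/
noncomputable def chiSq (n s : ℕ) (x : Finset ℕ) : ℝ :=
  ∑ y ∈ (Finset.Icc 1 n).powerset, (Kpow n s x y - piDist n y) ^ 2 / piDist n y

/-- Eigenvalues. -/
noncomputable def betaEV (k : ℕ) : ℝ := (((2 * k).choose k : ℝ)) ^ 2 / 16 ^ k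

/-- The eigenvectors f_S of Diaconis–Lin–Ram. -/
noncomputable def fSvec (S : Finset ℕ) : Finset ℕ → ℝ :=
  fun U => (-1 : ℝ) ^ ((S ∩ U).card) * (S.card.choose ((S ∩ U).card))

/-- Inner product with respect to π. -/
noncomputable def innerPi (n : ℕ) (f g : Finset ℕ → ℝ) : ℝ :=
  ∑ U ∈ (Finset.Icc 1 n).powerset, f U * g U * piDist n U

/-- The scalars T_{m,n}^{(ℓ)}(i). -/
noncomputable def Tcoef (n m ℓ i : ℕ) : ℝ :=
  ∑ j ∈ Finset.range (i + 1),
    if j ≤ ℓ then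
      (-1 : ℝ) ^ (m + j) * ((2 * m + ℓ).choose (m + j)) * (i.choose j) *
        ((n - 2 * m - i).choose (ℓ - j))
    else 0

/-- The vector g_T^{m,i} associated to the column reading tableau. -/
noncomputable def gT (n m i : ℕ) : Finset ℕ → ℝ := fun U =>
  if (∀ r ∈ Finset.Icc 1 m, ((2 * r - 1 ∈ U) ↔ ¬(2 * r ∈ U))) ∧
      (U ∩ Finset.Icc (2 * m + 1) n).card = i then
    (-1 : ℝ) ^ ((U ∩ (Finset.range m).image (fun r => 2 * r + 1)).card)
  else 0

/-- The vector f_T^{m,ℓ} associated to the column reading tableau. -/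
noncomputable def fT (n m ℓ : ℕ) : Finset ℕ → ℝ :=
  fun U => ∑ i ∈ Finset.range (n - 2 * m + 1), Tcoef n m ℓ i * gT n m i U

/-- Action of the adjacent transposition s_t (switching t and t+1) on functions. -/
noncomputable def sOp (t : ℕ) (f : Finset ℕ → ℝ) : Finset ℕ → ℝ :=
  fun U => f (U.image (Equiv.swap t (t + 1)))

/-- The factor s_t − 1/(t − 2r + 2) (r is the 1-indexed position in the second row). -/
noncomputable def tauFactor (r t : ℕ) (f : Finset ℕ → ℝ) : Finset ℕ → ℝ :=
  fun U => sOp t f U - ((t : ℝ) - 2 * r + 2)⁻¹ * f U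

/-- Composition (s_{2r+k-1} − ⋯)⋯(s_{2r} − 1/2) of k successive factors. -/
noncomputable def tauComp (r : ℕ) : ℕ → (Finset ℕ → ℝ) → (Finset ℕ → ℝ)
  | 0 => id
  | k + 1 => fun f => tauFactor r (2 * r + k) (tauComp r k f)

/-- τ_Q^{(r)} τ_Q^{(r+1)} ⋯ for the remaining second-row entries. -/
noncomputable def tauQAux : ℕ → List ℕ → (Finset ℕ → ℝ) → (Finset ℕ → ℝ)
  | _, [] => id
  | r, a :: rest => fun f => tauComp r (a - 2 * r) (tauQAux (r + 1) rest f)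

/-- The operator τ_Q for a tableau Q encoded by its list of second-row entries. -/
noncomputable def tauQ (Q : List ℕ) : (Finset ℕ → ℝ) → (Finset ℕ → ℝ) := tauQAux 1 Q

/-- A standard Young tableau of shape (n − Q.length, Q.length), encoded by the strictly
increasing list of second-row entries, each entry a_r satisfying 2r ≤ a_r ≤ n. -/
def IsSYT (n : ℕ) (Q : List ℕ) : Prop :=
  Q.Chain' (· < ·) ∧ (∀ x ∈ Q, x ≤ n) ∧ ∀ r < Q.length, 2 * (r + 1) ≤ Q.getD r 0

/-- The eigenvectors f_Q^{m,ℓ} (here m = Q.length). -/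
noncomputable def fQvec (n : ℕ) (Q : List ℕ) (ℓ : ℕ) : Finset ℕ → ℝ :=
  tauQ Q (fT n Q.length ℓ)

/-- The orthogonal vectors g_Q^{m,i} (here m = Q.length). -/
noncomputable def gQvec (n : ℕ) (Q : List ℕ) (i : ℕ) : Finset ℕ → ℝ :=
  tauQ Q (gT n Q.length i)

/-- The constant γ_Q. -/
noncomputable def gammaQ (Q : List ℕ) : ℝ :=
  ∏ r ∈ Finset.range Q.length, ∏ c ∈ Finset.Icc 2 (Q.getD r 0 - 2 * (r + 1) + 1),
    ((c : ℝ) ^ 2 - 1) / (c : ℝ) ^ 2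

/-- The Murphy (Jucys–Murphy) operator M_r acting on functions. -/
noncomputable def murphy (r : ℕ) (f : Finset ℕ → ℝ) : Finset ℕ → ℝ :=
  fun U => ∑ i ∈ Finset.Icc 1 (r - 1), f (U.image (Equiv.swap i r))

/-- The state space as a finite type. -/
noncomputable def transpEndo (n a b : ℕ) :
    Module.End ℝ ((↥((Finset.Icc 1 n).powerset)) → ℝ) where
  toFun f U := f (if h : U.1.image (Equiv.swap a b) ∈ (Finset.Icc 1 n).powerset
    then ⟨U.1.image (Equiv.swap a b), h⟩ else U)
  map_add' f g := rfl
  map_smul' c f := rfl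

noncomputable def murphyEndo (n r : ℕ) :
    Module.End ℝ ((↥((Finset.Icc 1 n).powerset)) → ℝ) :=
  ∑ i ∈ Finset.Icc 1 (r - 1), transpEndo n i r

noncomputable def KEndo (n : ℕ) :
    Module.End ℝ ((↥((Finset.Icc 1 n).powerset)) → ℝ) where
  toFun f x := ∑ y : ↥((Finset.Icc 1 n).powerset), Kmat n x.1 y.1 * f y
  map_add' f g := by funext x; simp [mul_add, Finset.sum_add_distrib]
  map_smul' c f := by funext x; simp [Finset.mul_sum, mul_left_comm]

section BurnsideSpectralBound

open Polynomial TensorProduct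

/-- The moment functional of the arcsine law on `[0, 1]`. -/
noncomputable def arcsineMoment : ℝ[X] →ₗ[ℝ] ℝ :=
  Polynomial.lsum fun j => ((j.centralBinom : ℝ) / 4 ^ j) • LinearMap.id

lemma arcsineMoment_X_pow (j : ℕ) :
    arcsineMoment (X ^ j) = (j.centralBinom : ℝ) / 4 ^ j := by
  rw [arcsineMoment, Polynomial.lsum_apply, Polynomial.X_pow_eq_monomial,
    Polynomial.sum_monomial_index] <;> simp

lemma arcsineMoment_one : arcsineMoment 1 = 1 := by
  simpa using arcsineMoment_X_pow 0

lemma centralBinom_succ_cast (j : ℕ) :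
    ((j + 1).centralBinom : ℝ) = 2 * (2 * j + 1) / (j + 1) * j.centralBinom := by
  have h : ((j : ℝ) + 1) * (j + 1).centralBinom = 2 * (2 * j + 1) * j.centralBinom := by
    exact_mod_cast Nat.succ_mul_centralBinom_succ j
  field_simp
  linarith

/-- Integration by parts against the arcsine law. -/
lemma arcsineMoment_derivative (f : ℝ[X]) :
    arcsineMoment (X * (1 - X) * derivative f + (C (1 / 2) - X) * f) = 0 := by
  induction f using Polynomial.induction_on' with
  | add p q hp hq =>
    have h : X * (1 - X) * derivative (p + q) + (C (1 / 2) - X) * (p + q) =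
        (X * (1 - X) * derivative p + (C (1 / 2) - X) * p) +
          (X * (1 - X) * derivative q + (C (1 / 2) - X) * q) := by
      rw [derivative_add]
      ring
    rw [h, map_add, hp, hq, add_zero]
  | monomial j a =>
    have h : X * (1 - X) * derivative (monomial j a) + (C (1 / 2) - X) * monomial j a =
        (a * (j + 1 / 2)) • (X : ℝ[X]) ^ j - (a * (j + 1)) • (X : ℝ[X]) ^ (j + 1) := by
      rw [derivative_monomial, ← C_mul_X_pow_eq_monomial, ← C_mul_X_pow_eq_monomial,
        smul_eq_C_mul, smul_eq_C_mul]
      rcases j with _ | j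
      · simp
        ring
      · simp only [C_mul, C_add, Nat.add_sub_cancel, Nat.cast_add, Nat.cast_one, C_1]
        ring
    rw [h, map_sub, map_smul, map_smul, arcsineMoment_X_pow, arcsineMoment_X_pow,
      centralBinom_succ_cast, smul_eq_mul, smul_eq_mul, pow_succ]
    field_simp
    ring

lemma arcsineMoment_beta (b a : ℕ) :
    arcsineMoment (X ^ a * (1 - X) ^ b) =
      (a.centralBinom * b.centralBinom : ℝ) / (4 ^ (a + b) * (a + b).choose a) := by
  induction b generalizing a with
  | zero => simp [arcsineMoment_X_pow]
  | succ b ih =>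
    have h : (X : ℝ[X]) ^ a * (1 - X) ^ (b + 1) =
        X ^ a * (1 - X) ^ b - X ^ (a + 1) * (1 - X) ^ b := by ring
    have h1 : ((a + b + 1).choose a : ℝ) * (b + 1) = (a + b).choose a * (a + b + 1) := by
      have := Nat.choose_mul_succ_eq (a + b) a
      rw [show a + b + 1 - a = b + 1 by omega] at this
      exact_mod_cast this.symm
    have h2 : ((a + b + 1).choose (a + 1) : ℝ) * (a + 1) = (a + b).choose a * (a + b + 1) := by
      have := Nat.add_one_mul_choose_eq (a + b) a
      rw [mul_comm] at this
      exact_mod_cast this.symm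
    have h0 : ((a + b).choose a : ℝ) ≠ 0 := by
      exact_mod_cast (Nat.choose_pos (by omega)).ne'
    have h1' : ((a + b + 1).choose a : ℝ) = (a + b).choose a * (a + b + 1) / (b + 1) := by
      field_simp; linarith
    have h2' : ((a + b + 1).choose (a + 1) : ℝ) =
        (a + b).choose a * (a + b + 1) / (a + 1) := by
      field_simp; linarith
    rw [h, map_sub, ih, ih, show a + 1 + b = a + b + 1 by ring, ← add_assoc, h1', h2',
      centralBinom_succ_cast, centralBinom_succ_cast, pow_succ]
    have : (a : ℝ) + b + 1 ≠ 0 := by positivity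
    field_simp
    ring

lemma arcsineMoment_centered_succ_succ (j : ℕ) :
    arcsineMoment ((X - C (1 / 2)) ^ (j + 2)) =
      (j + 1) / (4 * (j + 2)) * arcsineMoment ((X - C (1 / 2)) ^ j) := by
  have h := arcsineMoment_derivative ((X - C (1 / 2)) ^ (j + 1))
  have e : X * (1 - X) * derivative ((X - C (1 / 2 : ℝ)) ^ (j + 1)) +
      (C (1 / 2) - X) * (X - C (1 / 2)) ^ (j + 1) =
      (((j : ℝ) + 1) / 4) • (X - C (1 / 2)) ^ j - ((j : ℝ) + 2) • (X - C (1 / 2)) ^ (j + 2) := by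
    rw [derivative_X_sub_C_pow, smul_eq_C_mul, smul_eq_C_mul]
    have h4 : (C (((j : ℝ) + 1) / 4) : ℝ[X]) = (C (j : ℝ) + 1) * C (1 / 2) ^ 2 := by
      rw [← C_1, ← C_add, ← C_pow, ← C_mul]; congr 1; ring
    have h2 : (1 : ℝ[X]) = 2 * C (1 / 2) := by
      rw [← C_1, ← C_ofNat, ← C_mul]; congr 1; norm_num
    rw [h4, C_add]
    simp only [Nat.cast_add, Nat.cast_one, Nat.add_sub_cancel, C_add, C_1, C_ofNat]
    have h3 : X * (1 - X) = C (1 / 2) ^ 2 - (X - C (1 / 2 : ℝ)) ^ 2 := by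
      nth_rewrite 1 [h2]; ring
    rw [h3]
    ring
  rw [e, map_sub, map_smul, map_smul, smul_eq_mul, smul_eq_mul] at h
  field_simp at h ⊢
  linarith

lemma arcsineMoment_centered_even (k : ℕ) :
    arcsineMoment ((X - C (1 / 2)) ^ (2 * k)) = (k.centralBinom : ℝ) / 16 ^ k := by
  induction k with
  | zero => simp [arcsineMoment_one]
  | succ k ih =>
    rw [show 2 * (k + 1) = 2 * k + 2 by ring, arcsineMoment_centered_succ_succ, ih,
      centralBinom_succ_cast, pow_succ]
    push_cast
    field_simp
    ring

lemma arcsineMoment_centered_odd (k : ℕ) :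
    arcsineMoment ((X - C (1 / 2)) ^ (2 * k + 1)) = 0 := by
  induction k with
  | zero =>
    have h : arcsineMoment (C (1 / 2)) = 1 / 2 := by
      rw [← mul_one (C (1 / 2)), ← smul_eq_C_mul, map_smul, arcsineMoment_one]; simp
    have := arcsineMoment_X_pow 1
    simp only [pow_one, Nat.centralBinom] at this
    rw [mul_zero, zero_add, pow_one, map_sub, h, this]
    norm_num
  | succ k ih =>
    rw [show 2 * (k + 1) + 1 = (2 * k + 1) + 2 by ring, arcsineMoment_centered_succ_succ, ih,
      mul_zero]

/-- The joint moment functional of two independent arcsine variables. -/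
noncomputable def jointMoment : ℝ[X] ⊗[ℝ] ℝ[X] →ₗ[ℝ] ℝ :=
  LinearMap.mul' ℝ ℝ ∘ₗ TensorProduct.map arcsineMoment arcsineMoment

lemma jointMoment_tmul (f g : ℝ[X]) :
    jointMoment (f ⊗ₜ g) = arcsineMoment f * arcsineMoment g := by
  simp [jointMoment]

/-- The eigenvalue of the Burnside chain in degree `t`. -/
noncomputable def degreeEigenvalue (t : ℕ) : ℝ :=
  jointMoment (((X : ℝ[X]) ⊗ₜ[ℝ] (1 : ℝ[X]) - (1 : ℝ[X]) ⊗ₜ[ℝ] (X : ℝ[X])) ^ t)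

lemma degreeEigenvalue_eq_sum (t : ℕ) :
    degreeEigenvalue t = ∑ j ∈ Finset.range (t + 1), (-1 : ℝ) ^ (j + t) *
      (arcsineMoment ((X - C (1 / 2)) ^ j) * arcsineMoment ((X - C (1 / 2)) ^ (t - j))) *
        t.choose j := by
  have h : (X : ℝ[X]) ⊗ₜ[ℝ] (1 : ℝ[X]) - (1 : ℝ[X]) ⊗ₜ[ℝ] (X : ℝ[X]) =
      (X - C (1 / 2) : ℝ[X]) ⊗ₜ[ℝ] (1 : ℝ[X]) - (1 : ℝ[X]) ⊗ₜ[ℝ] (X - C (1 / 2) : ℝ[X]) := by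
    have hc : (C (1 / 2 : ℝ) : ℝ[X]) ⊗ₜ[ℝ] (1 : ℝ[X]) = (1 : ℝ[X]) ⊗ₜ[ℝ] C (1 / 2 : ℝ) := by
      rw [show (C (1 / 2 : ℝ)) = (1 / 2 : ℝ) • (1 : ℝ[X]) by rw [smul_eq_C_mul, mul_one],
        TensorProduct.smul_tmul]
    rw [TensorProduct.sub_tmul, TensorProduct.tmul_sub, hc]
    abel
  rw [degreeEigenvalue, h, sub_pow, map_sum]
  refine Finset.sum_congr rfl fun j _ => ?_
  rw [Algebra.TensorProduct.tmul_pow, Algebra.TensorProduct.tmul_pow, mul_assoc, mul_assoc,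
    ← mul_assoc (_ ⊗ₜ[ℝ] _), Algebra.TensorProduct.tmul_mul_tmul, one_pow, one_pow, mul_one,
    one_mul]
  have e : ∀ z : ℝ[X] ⊗[ℝ] ℝ[X], (-1) ^ (j + t) * (z * ((t.choose j : ℕ) : ℝ[X] ⊗[ℝ] ℝ[X])) =
      ((-1 : ℝ) ^ (j + t) * t.choose j) • z := by
    intro z
    refine Eq.trans ?_ (Algebra.smul_def ((-1 : ℝ) ^ (j + t) * t.choose j) z).symm
    simp only [map_mul, map_pow, map_neg, map_one, map_natCast]
    ring
  rw [e, map_smul, jointMoment_tmul, smul_eq_mul]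
  ring

lemma degreeEigenvalue_odd (k : ℕ) : degreeEigenvalue (2 * k + 1) = 0 := by
  rw [degreeEigenvalue_eq_sum]
  refine Finset.sum_eq_zero fun j hj => ?_
  rw [Finset.mem_range] at hj
  rcases Nat.even_or_odd' j with ⟨i, rfl | rfl⟩
  · rw [show 2 * k + 1 - 2 * i = 2 * (k - i) + 1 by omega, arcsineMoment_centered_odd]
    ring
  · rw [arcsineMoment_centered_odd]
    ring

lemma degreeEigenvalue_even (k : ℕ) : degreeEigenvalue (2 * k) = betaEV k := by
  rw [degreeEigenvalue_eq_sum]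
  have hsub : (Finset.range (k + 1)).image (fun i => 2 * i) ⊆ Finset.range (2 * k + 1) := by
    intro j hj
    simp only [Finset.mem_image, Finset.mem_range] at hj ⊢
    obtain ⟨i, hi, rfl⟩ := hj
    omega
  rw [← Finset.sum_subset hsub, Finset.sum_image (by intro a _ b _ h; simpa using h)]
  · have h : ∀ i ∈ Finset.range (k + 1), (-1 : ℝ) ^ (2 * i + 2 * k) *
        (arcsineMoment ((X - C (1 / 2)) ^ (2 * i)) *
          arcsineMoment ((X - C (1 / 2)) ^ (2 * k - 2 * i))) * (2 * k).choose (2 * i) =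
        (k.centralBinom : ℝ) / 16 ^ k * ((k.choose i) ^ 2 : ℕ) := by
      intro i hi
      have hik : i ≤ k := by simpa [Nat.lt_succ_iff] using hi
      obtain ⟨d, rfl⟩ := Nat.exists_eq_add_of_le hik
      rw [show 2 * (i + d) - 2 * i = 2 * d by omega, arcsineMoment_centered_even,
        arcsineMoment_centered_even, show 2 * i + 2 * (i + d) = 2 * (i + (i + d)) by ring,
        pow_mul]
      have f1 := Nat.add_choose_mul_factorial_mul_factorial d i
      have f2 := Nat.add_choose_mul_factorial_mul_factorial (2 * d) (2 * i)
      have f3 := Nat.add_choose_mul_factorial_mul_factorial i i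
      have f4 := Nat.add_choose_mul_factorial_mul_factorial d d
      have f5 := Nat.add_choose_mul_factorial_mul_factorial (i + d) (i + d)
      rw [add_comm (2 * d), mul_right_comm] at f2
      rw [add_comm d, mul_right_comm] at f1
      simp only [← two_mul, mul_add] at f1 f2 f3 f4 f5 ⊢
      simp only [Nat.centralBinom, mul_add]
      have p1 := Nat.factorial_pos i
      have p2 := Nat.factorial_pos d
      have key : (2 * i).choose i * (2 * d).choose d * (2 * i + 2 * d).choose (2 * i) =
          (2 * i + 2 * d).choose (i + d) * (i + d).choose i ^ 2 := by
        have : 0 < i.factorial ^ 2 * d.factorial ^ 2 := by positivity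
        apply Nat.eq_of_mul_eq_mul_right this
        calc _ = (2 * i + 2 * d).choose (2 * i) * ((2 * i).choose i * i.factorial * i.factorial) *
              ((2 * d).choose d * d.factorial * d.factorial) := by ring
          _ = (2 * i + 2 * d).choose (i + d) * ((i + d).choose i * i.factorial * d.factorial) *
              ((i + d).choose i * i.factorial * d.factorial) := by rw [f3, f4, f2, f1, f5]
          _ = _ := by ring
      have key' := congrArg (Nat.cast (R := ℝ)) key
      push_cast at key' ⊢
      rw [pow_add (16 : ℝ)]
      simp only [even_two, Even.neg_pow, one_pow, one_mul]
      field_simp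
      linarith
    rw [Finset.sum_congr rfl h, ← Finset.mul_sum, ← Nat.cast_sum, Nat.sum_range_choose_sq,
      betaEV, Nat.centralBinom]
    ring
  · intro j _ hj
    rcases Nat.even_or_odd' j with ⟨i, rfl | rfl⟩
    · exfalso
      apply hj
      simp only [Finset.mem_image, Finset.mem_range] at *
      exact ⟨i, by omega, rfl⟩
    · rw [arcsineMoment_centered_odd]
      ring

/-- Integration of polynomials over `[0, 1]`. -/
noncomputable def unitIntegral : ℝ[X] →ₗ[ℝ] ℝ where
  toFun f := ∫ x in (0 : ℝ)..1, f.eval x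
  map_add' f g := by
    simp only [eval_add]
    exact intervalIntegral.integral_add (f.continuous.intervalIntegrable _ _)
      (g.continuous.intervalIntegrable _ _)
  map_smul' c f := by simp [eval_smul]

lemma unitIntegral_X_pow (j : ℕ) : unitIntegral (X ^ j) = 1 / ((j : ℝ) + 1) := by
  simp [unitIntegral, integral_pow]

lemma unitIntegral_mono {f g : ℝ[X]} (h : ∀ x ∈ Set.Icc (0 : ℝ) 1, f.eval x ≤ g.eval x) :
    unitIntegral f ≤ unitIntegral g :=
  intervalIntegral.integral_mono_on zero_le_one (f.continuous.intervalIntegrable _ _)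
    (g.continuous.intervalIntegrable _ _) h

lemma unitIntegral_beta (b a : ℕ) :
    unitIntegral (X ^ a * (1 - X) ^ b) = 1 / (((a + b : ℕ) + 1 : ℝ) * (a + b).choose a) := by
  induction b generalizing a with
  | zero => simp [unitIntegral_X_pow]
  | succ b ih =>
    have h : (X : ℝ[X]) ^ a * (1 - X) ^ (b + 1) =
        X ^ a * (1 - X) ^ b - X ^ (a + 1) * (1 - X) ^ b := by ring
    have h1 : ((a + b + 1).choose a : ℝ) * (b + 1) = (a + b).choose a * (a + b + 1) := by
      have := Nat.choose_mul_succ_eq (a + b) a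
      rw [show a + b + 1 - a = b + 1 by omega] at this
      exact_mod_cast this.symm
    have h2 : ((a + b + 1).choose (a + 1) : ℝ) * (a + 1) = (a + b).choose a * (a + b + 1) := by
      have := Nat.add_one_mul_choose_eq (a + b) a
      rw [mul_comm] at this
      exact_mod_cast this.symm
    have h0 : ((a + b).choose a : ℝ) ≠ 0 := by
      exact_mod_cast (Nat.choose_pos (by omega)).ne'
    have h1' : ((a + b + 1).choose a : ℝ) = (a + b).choose a * (a + b + 1) / (b + 1) := by
      field_simp; linarith
    have h2' : ((a + b + 1).choose (a + 1) : ℝ) =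
        (a + b).choose a * (a + b + 1) / (a + 1) := by
      field_simp; linarith
    rw [h, map_sub, ih, ih, show a + 1 + b = a + b + 1 by ring, ← add_assoc, h1', h2']
    push_cast
    have : (a : ℝ) + b + 1 ≠ 0 := by positivity
    have : (a : ℝ) + b + 1 + 1 ≠ 0 := by positivity
    field_simp
    ring

/-- Cauchy–Schwarz for the weight `x` on `[0, 1]`, in the presence of a reproducing kernel. -/
lemma sq_le_of_reproducing {R A : ℝ[X]} {r a : ℝ} (hr : 0 < r)
    (hRR : unitIntegral (X * R * R) = r) (hRA : unitIntegral (X * R * A) = a) :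
    a ^ 2 ≤ r * unitIntegral (X * A ^ 2) := by
  have h : 0 ≤ unitIntegral (X * (a • R - r • A) ^ 2) := by
    rw [← map_zero unitIntegral]
    refine unitIntegral_mono fun x hx => ?_
    simpa using mul_nonneg hx.1 (sq_nonneg _)
  have e : X * (a • R - r • A) ^ 2 =
      (a ^ 2) • (X * R * R) - (2 * a * r) • (X * R * A) + (r ^ 2) • (X * A ^ 2) := by
    simp only [smul_eq_C_mul, C_mul, C_pow, C_ofNat]
    ring
  rw [e, map_add, map_sub, map_smul, map_smul, map_smul, hRR, hRA] at h
  simp only [smul_eq_mul] at h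
  have : 0 ≤ r * (r * unitIntegral (X * A ^ 2) - a ^ 2) := by nlinarith
  have := nonneg_of_mul_nonneg_right this hr
  linarith

lemma sum_alternating_choose_mul_eval {f : ℝ[X]} {L : ℕ} (hf : f.natDegree < L) :
    ∑ i ∈ Finset.range (L + 1), (-1 : ℝ) ^ i * L.choose i * f.eval (i : ℝ) = 0 := by
  have h := congrFun (Polynomial.fwdDiff_iter_eq_zero_of_degree_lt hf) 0
  rw [fwdDiff_iter_eq_sum_shift] at h
  have h' : (-1 : ℝ) ^ L * ∑ i ∈ Finset.range (L + 1),
      (-1 : ℝ) ^ i * L.choose i * f.eval (i : ℝ) = 0 := by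
    rw [← Pi.zero_apply (M := fun _ : ℝ => ℝ) 0, ← h, Finset.mul_sum]
    refine Finset.sum_congr rfl fun i hi => ?_
    have hi : i ≤ L := by simpa [Nat.lt_succ_iff] using hi
    obtain ⟨d, rfl⟩ := Nat.exists_eq_add_of_le hi
    rw [Nat.add_sub_cancel_left, pow_add]
    have : ((-1 : ℝ) ^ i) * (-1) ^ i = 1 := by rw [← mul_pow]; simp
    simp only [zsmul_eq_mul, nsmul_eq_mul, mul_one, zero_add]
    push_cast
    linear_combination (-1 : ℝ) ^ d * ((i + d).choose i) * f.eval (i : ℝ) * this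
  exact (mul_eq_zero.mp h').resolve_left (pow_ne_zero _ (by norm_num))

lemma sum_alternating_choose_div (L : ℕ) :
    ∑ i ∈ Finset.range (L + 1), (-1 : ℝ) ^ i * L.choose i * (1 / ((i : ℝ) + 2)) =
      1 / ((L + 1) * (L + 2)) := by
  have h := unitIntegral_beta L 1
  have e : (X : ℝ[X]) ^ 1 * (1 - X) ^ L =
      ∑ i ∈ Finset.range (L + 1), ((-1 : ℝ) ^ i * L.choose i) • (X : ℝ[X]) ^ (i + 1) := by
    rw [show (1 : ℝ[X]) - X = -X + 1 by ring, add_pow, Finset.mul_sum]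
    refine Finset.sum_congr rfl fun i _ => ?_
    rw [smul_eq_C_mul, neg_pow]
    simp only [C_mul, C_pow, C_neg, C_1, map_natCast, one_pow]
    ring
  rw [e, map_sum] at h
  simp only [map_smul, unitIntegral_X_pow, smul_eq_mul, Nat.choose_one_right] at h
  rw [show ((1 + L : ℕ) : ℝ) = L + 1 by push_cast; ring] at h
  convert h using 1
  · refine Finset.sum_congr rfl fun i _ => ?_
    push_cast
    ring
  · ring

/-- The polynomial interpolating the coefficients of the reproducing kernel. -/
noncomputable def kernelCoeffPoly (L : ℕ) : ℝ[X] :=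
  ∏ j ∈ Finset.range L, (X + C ((j : ℝ) + 3))

lemma natDegree_kernelCoeffPoly (L : ℕ) : (kernelCoeffPoly L).natDegree = L := by
  rw [kernelCoeffPoly, natDegree_prod_of_monic _ _ fun j _ => monic_X_add_C _]
  simp only [natDegree_X_add_C, Finset.sum_const, Finset.card_range, smul_eq_mul, mul_one]

lemma sum_kernelCoeffPoly_div {L : ℕ} (hL : 1 ≤ L) (j : ℕ) :
    ∑ i ∈ Finset.range (L + 1), (-1 : ℝ) ^ i * L.choose i *
      ((kernelCoeffPoly L).eval (i : ℝ) / ((i : ℝ) + (j + 2))) =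
    (kernelCoeffPoly L).eval (-((j : ℝ) + 2)) *
      ∑ i ∈ Finset.range (L + 1), (-1 : ℝ) ^ i * L.choose i * (1 / ((i : ℝ) + (j + 2))) := by
  set N := kernelCoeffPoly L
  set a : ℝ := -((j : ℝ) + 2)
  have hq : (N /ₘ (X - C a)).natDegree < L := by
    rw [natDegree_divByMonic _ (monic_X_sub_C a), natDegree_kernelCoeffPoly, natDegree_X_sub_C]
    omega
  have h0 := sum_alternating_choose_mul_eval hq
  rw [Finset.mul_sum, ← sub_eq_zero, ← Finset.sum_sub_distrib, ← h0]
  refine Finset.sum_congr rfl fun i _ => ?_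
  have hm := congrArg (eval (i : ℝ)) (modByMonic_add_div N (X - C a))
  rw [modByMonic_X_sub_C_eq_C_eval] at hm
  simp only [eval_add, eval_C, eval_mul, eval_sub, eval_X] at hm
  have hi : (i : ℝ) - a = i + (j + 2) := by simp only [a]; ring
  rw [hi] at hm
  have hne : (i : ℝ) + (j + 2) ≠ 0 := by positivity
  rw [← hm]
  field_simp
  ring

lemma eval_kernelCoeffPoly_zero (L : ℕ) :
    (kernelCoeffPoly L).eval 0 = (L.factorial : ℝ) * ((L + 1) * (L + 2)) / 2 := by
  induction L with
  | zero => simp [kernelCoeffPoly]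
  | succ L ih =>
    rw [kernelCoeffPoly, Finset.prod_range_succ, eval_mul, ← kernelCoeffPoly, ih,
      Nat.factorial_succ]
    simp
    ring

lemma eval_kernelCoeffPoly_neg_two (L : ℕ) :
    (kernelCoeffPoly L).eval (-2) = (L.factorial : ℝ) := by
  induction L with
  | zero => simp [kernelCoeffPoly]
  | succ L ih =>
    rw [kernelCoeffPoly, Finset.prod_range_succ, eval_mul, ← kernelCoeffPoly, ih,
      Nat.factorial_succ]
    simp
    ring

lemma eval_kernelCoeffPoly_eq_zero {L j : ℕ} (hj : j < L) :
    (kernelCoeffPoly L).eval (-(((j + 1 : ℕ) : ℝ) + 2)) = 0 := by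
  rw [kernelCoeffPoly, eval_prod]
  refine Finset.prod_eq_zero (Finset.mem_range.mpr hj) ?_
  simp
  ring

/-- The reproducing kernel at `0` of polynomials of degree at most `L` for the weight `x`. -/
noncomputable def kernelPoly (L : ℕ) : ℝ[X] :=
  ∑ i ∈ Finset.range (L + 1), (((L : ℝ) + 1) * (L + 2) / L.factorial *
    ((-1 : ℝ) ^ i * L.choose i * (kernelCoeffPoly L).eval (i : ℝ))) • X ^ i

lemma unitIntegral_kernelPoly_X_pow {L : ℕ} (hL : 1 ≤ L) {j : ℕ} (hj : j ≤ L) :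
    unitIntegral (X * kernelPoly L * X ^ j) = if j = 0 then 1 else 0 := by
  have e : unitIntegral (X * kernelPoly L * X ^ j) = ((L : ℝ) + 1) * (L + 2) / L.factorial *
      ∑ i ∈ Finset.range (L + 1), (-1 : ℝ) ^ i * L.choose i *
        ((kernelCoeffPoly L).eval (i : ℝ) / ((i : ℝ) + (j + 2))) := by
    rw [kernelPoly, Finset.mul_sum, Finset.sum_mul, map_sum, Finset.mul_sum]
    refine Finset.sum_congr rfl fun i _ => ?_
    rw [mul_smul_comm, smul_mul_assoc, ← pow_succ', ← pow_add, map_smul, unitIntegral_X_pow,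
      smul_eq_mul]
    push_cast
    rw [show (i : ℝ) + 1 + j + 1 = i + (j + 2) by ring]
    ring
  rw [e, sum_kernelCoeffPoly_div hL]
  rcases j with _ | j
  · have := sum_alternating_choose_div L
    have hf : (L.factorial : ℝ) ≠ 0 := by exact_mod_cast L.factorial_ne_zero
    simp only [Nat.cast_zero, zero_add, if_true, this, eval_kernelCoeffPoly_neg_two]
    field_simp
  · rw [eval_kernelCoeffPoly_eq_zero (by omega)]
    simp

lemma unitIntegral_kernelPoly {L : ℕ} (hL : 1 ≤ L) {A : ℝ[X]} (hA : A.natDegree ≤ L) :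
    unitIntegral (X * kernelPoly L * A) = A.eval 0 := by
  rw [A.as_sum_range_C_mul_X_pow' (Nat.lt_succ_of_le hA), Finset.mul_sum, map_sum, eval_finsetSum]
  refine Finset.sum_congr rfl fun j hj => ?_
  rw [mul_left_comm, ← smul_eq_C_mul, map_smul,
    unitIntegral_kernelPoly_X_pow hL (by simpa [Nat.lt_succ_iff] using hj)]
  rcases j with _ | j <;> simp

/-- The sharp bound on the value at `0` of a polynomial with given weighted `L²` norm. -/
lemma eval_zero_sq_le {L : ℕ} (hL : 1 ≤ L) {A : ℝ[X]} (hA : A.natDegree ≤ L) :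
    A.eval 0 ^ 2 ≤ ((L : ℝ) + 1) ^ 2 * (L + 2) ^ 2 / 2 * unitIntegral (X * A ^ 2) := by
  have hdeg : (kernelPoly L).natDegree ≤ L := by
    refine natDegree_sum_le_of_forall_le _ _ fun i hi => ?_
    refine (natDegree_smul_le _ _).trans ?_
    rw [natDegree_X_pow]
    simpa [Nat.lt_succ_iff] using hi
  have h0 : (kernelPoly L).eval 0 = ((L : ℝ) + 1) ^ 2 * (L + 2) ^ 2 / 2 := by
    rw [kernelPoly, eval_finsetSum, Finset.sum_eq_single 0]
    · have hf : (L.factorial : ℝ) ≠ 0 := by exact_mod_cast L.factorial_ne_zero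
      simp only [eval_smul, eval_one, smul_eq_mul, Nat.cast_zero,
        eval_kernelCoeffPoly_zero, pow_zero, Nat.choose_zero_right, Nat.cast_one]
      field_simp
    · intro i _ hi
      simp [hi]
    · simp
  refine sq_le_of_reproducing (by positivity) ?_ (unitIntegral_kernelPoly hL hA)
  rw [unitIntegral_kernelPoly hL hdeg, h0]

lemma sum_powerset_prod_mul_prod_sdiff {A : Type*} [CommRing A] (ξ : ℕ → A) {S I : Finset ℕ}
    (h : S ⊆ I) :
    ∑ y ∈ I.powerset, ((∏ i ∈ y, ξ i) * ∏ i ∈ I \ y, (1 - ξ i)) * (if S ⊆ y then 1 else 0) =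
      ∏ i ∈ S, ξ i := by
  have h1 : ∏ i ∈ I, (ξ i + if i ∈ S then 0 else 1 - ξ i) = ∏ i ∈ S, ξ i := by
    rw [← Finset.prod_subset h]
    · exact Finset.prod_congr rfl fun i hi => by simp [hi]
    · intro i _ hi
      simp [hi]
  rw [← h1, Finset.prod_add]
  refine Finset.sum_congr rfl fun y _ => ?_
  by_cases hy : S ⊆ y
  · rw [if_pos hy, mul_one]
    congr 1
    refine Finset.prod_congr rfl fun i hi => ?_
    rw [if_neg fun hS => (Finset.mem_sdiff.mp hi).2 (hy hS)]
  · rw [if_neg hy, mul_zero]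
    obtain ⟨i, hiS, hiy⟩ := Finset.not_subset.mp hy
    rw [Finset.prod_eq_zero (i := i) (Finset.mem_sdiff.mpr ⟨h hiS, hiy⟩) (by simp [hiS]), mul_zero]

/-- The success parameter used to resample the coordinate `i` from the state `x`. -/
noncomputable def resampleVar (x : Finset ℕ) (i : ℕ) : ℝ[X] ⊗[ℝ] ℝ[X] :=
  if i ∈ x then (X : ℝ[X]) ⊗ₜ[ℝ] (1 : ℝ[X]) else (1 : ℝ[X]) ⊗ₜ[ℝ] (X : ℝ[X])

lemma prod_ite_mem_const {A : Type*} [CommMonoid A] (x y : Finset ℕ) (p q : A) :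
    ∏ i ∈ y, (if i ∈ x then p else q) = p ^ (x ∩ y).card * q ^ (y \ x).card := by
  rw [Finset.prod_ite, Finset.prod_const, Finset.prod_const, Finset.filter_mem_eq_inter,
    Finset.filter_notMem_eq_sdiff, Finset.inter_comm]

lemma card_sub_union {n : ℕ} {x y : Finset ℕ} (hx : x ⊆ Finset.Icc 1 n)
    (hy : y ⊆ Finset.Icc 1 n) :
    n - (x ∪ y).card = ((Finset.Icc 1 n \ y) \ x).card := by
  have h : (Finset.Icc 1 n \ y) \ x = Finset.Icc 1 n \ (x ∪ y) := by
    ext i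
    simp only [Finset.mem_sdiff, Finset.mem_union]
    tauto
  rw [h, Finset.card_sdiff_of_subset (Finset.union_subset hx hy), Nat.card_Icc, Nat.add_sub_cancel]

lemma Kmat_eq_jointMoment {n : ℕ} {x y : Finset ℕ} (hx : x ⊆ Finset.Icc 1 n)
    (hy : y ⊆ Finset.Icc 1 n) :
    Kmat n x y = jointMoment ((∏ i ∈ y, resampleVar x i) *
      ∏ i ∈ Finset.Icc 1 n \ y, (1 - resampleVar x i)) := by
  have e : ∀ i, 1 - resampleVar x i = if i ∈ x then ((1 : ℝ[X]) - X) ⊗ₜ[ℝ] (1 : ℝ[X])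
      else (1 : ℝ[X]) ⊗ₜ[ℝ] ((1 : ℝ[X]) - X) := by
    intro i
    unfold resampleVar
    split_ifs
    · rw [TensorProduct.sub_tmul, Algebra.TensorProduct.one_def]
    · rw [TensorProduct.tmul_sub, Algebra.TensorProduct.one_def]
  have hxy : x ∩ (Finset.Icc 1 n \ y) = x \ y := by
    ext i
    simp only [Finset.mem_inter, Finset.mem_sdiff]
    exact ⟨fun h => ⟨h.1, h.2.2⟩, fun h => ⟨h.1, hx h.1, h.2⟩⟩
  simp only [e]
  simp only [resampleVar]
  rw [prod_ite_mem_const, prod_ite_mem_const, hxy, ← card_sub_union hx hy]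
  simp only [Algebra.TensorProduct.tmul_pow, Algebra.TensorProduct.tmul_mul_tmul, one_pow, one_mul,
    mul_one]
  rw [jointMoment_tmul, arcsineMoment_beta, arcsineMoment_beta, Kmat]
  have hn : n = ((x ∩ y).card + (x \ y).card) + ((y \ x).card + (n - (x ∪ y).card)) := by
    have h1 : (x ∩ y).card + (x \ y).card = x.card := Finset.card_inter_add_card_sdiff x y
    have h2 : (x ∪ y).card = (y \ x).card + x.card := by
      rw [Finset.card_sdiff_add_card, Finset.union_comm]
    have h3 : (x ∪ y).card ≤ n := by
      simpa using Finset.card_le_card (Finset.union_subset hx hy)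
    omega
  generalize (x ∩ y).card = a at *
  generalize (x \ y).card = b at *
  generalize (y \ x).card = c at *
  generalize n - (x ∪ y).card = d at *
  subst hn
  rw [add_comm d c, add_comm b a, ← Nat.choose_symm_add (a := c) (b := d),
    ← Nat.choose_symm_add (a := a) (b := b), pow_add]
  simp only [Nat.centralBinom]
  rw [div_mul_div_comm]
  congr 1 <;> ring

lemma piDist_pos {n : ℕ} {x : Finset ℕ} (hx : x ⊆ Finset.Icc 1 n) : 0 < piDist n x := by
  have h : x.card ≤ n := by simpa using Finset.card_le_card hx
  have : 0 < n.choose x.card := Nat.choose_pos h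
  unfold piDist
  positivity

lemma piDist_mul_Kmat_comm {n : ℕ} {x y : Finset ℕ} (hx : x ⊆ Finset.Icc 1 n)
    (hy : y ⊆ Finset.Icc 1 n) :
    piDist n x * Kmat n x y = piDist n y * Kmat n y x := by
  have h1 : (x ∩ y).card + (x \ y).card = x.card := Finset.card_inter_add_card_sdiff x y
  have h1' : (x ∩ y).card + (y \ x).card = y.card := by
    rw [Finset.inter_comm]; exact Finset.card_inter_add_card_sdiff y x
  have h2 : (x ∪ y).card = (y \ x).card + x.card := by
    rw [Finset.card_sdiff_add_card, Finset.union_comm]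
  have h3 : (x ∪ y).card ≤ n := by
    simpa using Finset.card_le_card (Finset.union_subset hx hy)
  unfold piDist Kmat
  rw [Finset.union_comm y x, Finset.inter_comm y x, ← h1, ← h1']
  have hn : n = (x ∩ y).card + (x \ y).card + (y \ x).card + (n - (x ∪ y).card) := by omega
  generalize (x ∩ y).card = a at *
  generalize (x \ y).card = b at *
  generalize (y \ x).card = c at *
  generalize n - (x ∪ y).card = d at *
  clear h1 h1' h2 h3 hx hy
  have key : ∀ b c : ℕ, ((a + b + c + d).choose (a + b) : ℝ) * ((d + c).choose d) *
      ((b + a).choose b) * (a.factorial * b.factorial * c.factorial * d.factorial) =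
      (a + b + c + d).factorial := by
    intro b c
    have f1 := Nat.add_choose_mul_factorial_mul_factorial d c
    have f2 := Nat.add_choose_mul_factorial_mul_factorial b a
    have f3 := Nat.choose_mul_factorial_mul_factorial (n := a + b + c + d) (k := a + b) (by omega)
    rw [show a + b + c + d - (a + b) = d + c by omega, add_comm a b] at f3
    have g1 : (d + c).choose d = (d + c).choose c := Nat.choose_symm_add
    have g2 : (b + a).choose b = (b + a).choose a := Nat.choose_symm_add
    rw [← f1, ← f2, ← Nat.cast_inj (R := ℝ)] at f3
    rw [add_comm a b, g1, g2]
    push_cast at f3 ⊢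
    linarith
  have k1 := key b c
  have k2 := key c b
  rw [show a + c + b + d = a + b + c + d by ring, ← k1] at k2
  have hf : (a.factorial * b.factorial * c.factorial * d.factorial : ℝ) ≠ 0 := by
    exact_mod_cast (by positivity : a.factorial * b.factorial * c.factorial * d.factorial ≠ 0)
  have k3 : ((a + b + c + d).choose (a + c) : ℝ) * ((d + b).choose d) * ((c + a).choose c) =
      ((a + b + c + d).choose (a + b) : ℝ) * ((d + c).choose d) * ((b + a).choose b) := by
    apply mul_right_cancel₀ hf
    linarith
  rw [hn, div_mul_div_comm, div_mul_div_comm]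
  congr 1
  · ring
  · push_cast
    linear_combination (-(4 : ℝ) ^ (a + b + c + d) * (a + b + c + d + 1)) * k3

/-- The space of functions on the states of the binary Burnside process, to be equipped with the
inner product of `L²(π_n)`. -/
def StateFun (n : ℕ) : Type := ↥((Finset.Icc 1 n).powerset) → ℝ

noncomputable instance (n : ℕ) : AddCommGroup (StateFun n) :=
  inferInstanceAs (AddCommGroup (↥((Finset.Icc 1 n).powerset) → ℝ))

noncomputable instance (n : ℕ) : Module ℝ (StateFun n) :=
  inferInstanceAs (Module ℝ (↥((Finset.Icc 1 n).powerset) → ℝ))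

instance (n : ℕ) : FiniteDimensional ℝ (StateFun n) :=
  inferInstanceAs (FiniteDimensional ℝ (↥((Finset.Icc 1 n).powerset) → ℝ))

lemma StateFun.subset {n : ℕ} (x : ↥((Finset.Icc 1 n).powerset)) : x.1 ⊆ Finset.Icc 1 n :=
  Finset.mem_powerset.mp x.2

noncomputable instance (n : ℕ) : InnerProductSpace.Core ℝ (StateFun n) where
  inner f g := ∑ x, f x * g x * piDist n x.1
  conj_inner_symm f g := by
    simp only [conj_trivial]
    exact Finset.sum_congr rfl fun x _ => by ring
  re_inner_nonneg f := by
    rw [RCLike.re_to_real]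
    exact Finset.sum_nonneg fun x _ =>
      mul_nonneg (mul_self_nonneg (f x)) (piDist_pos (StateFun.subset x)).le
  add_left f g h := by
    rw [← Finset.sum_add_distrib]
    exact Finset.sum_congr rfl fun x _ => by
      rw [show (f + g) x = f x + g x from rfl]; ring
  smul_left f g c := by
    rw [Finset.mul_sum]
    exact Finset.sum_congr rfl fun x _ => by
      rw [show (c • f) x = c * f x from rfl, conj_trivial]; ring
  definite f hf := by
    funext x
    have hnn : ∀ x ∈ Finset.univ, 0 ≤ f x * f x * piDist n x.1 := fun x _ =>
      mul_nonneg (mul_self_nonneg (f x)) (piDist_pos (StateFun.subset x)).le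
    have h := (Finset.sum_eq_zero_iff_of_nonneg hnn).mp hf x (Finset.mem_univ x)
    have h0 : f x = 0 := by
      simpa [(piDist_pos (StateFun.subset x)).ne'] using h
    exact h0

noncomputable instance (n : ℕ) : NormedAddCommGroup (StateFun n) :=
  InnerProductSpace.Core.toNormedAddCommGroup (𝕜 := ℝ)

noncomputable instance (n : ℕ) : InnerProductSpace ℝ (StateFun n) :=
  InnerProductSpace.ofCore _

lemma StateFun.inner_eq {n : ℕ} (f g : StateFun n) :
    inner ℝ f g = ∑ x, f x * g x * piDist n x.1 := rfl

lemma StateFun.norm_sq_eq {n : ℕ} (f : StateFun n) :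
    ‖f‖ ^ 2 = ∑ x, f x ^ 2 * piDist n x.1 := by
  rw [← real_inner_self_eq_norm_sq, StateFun.inner_eq]
  exact Finset.sum_congr rfl fun x _ => by ring

/-- The monomial `∏_{i ∈ S} x_i`. -/
noncomputable def StateFun.mono (n : ℕ) (S : Finset ℕ) : StateFun n :=
  fun x => if S ⊆ x.1 then 1 else 0

/-- The functions of degree less than `L`. -/
noncomputable def StateFun.degreeLT (n L : ℕ) : Submodule ℝ (StateFun n) :=
  Submodule.span ℝ {f | ∃ S ⊆ Finset.Icc 1 n, S.card < L ∧ f = StateFun.mono n S}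

lemma StateFun.mono_mem_degreeLT {n L : ℕ} {S : Finset ℕ} (hS : S ⊆ Finset.Icc 1 n)
    (hL : S.card < L) : StateFun.mono n S ∈ StateFun.degreeLT n L :=
  Submodule.subset_span ⟨S, hS, hL, rfl⟩

lemma StateFun.degreeLT_mono (n : ℕ) : Monotone (StateFun.degreeLT n) := by
  intro L M hLM
  refine Submodule.span_mono ?_
  rintro f ⟨S, hS, hL, rfl⟩
  exact ⟨S, hS, hL.trans_le hLM, rfl⟩

lemma StateFun.degreeLT_zero (n : ℕ) : StateFun.degreeLT n 0 = ⊥ := by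
  rw [StateFun.degreeLT, Submodule.span_eq_bot]
  rintro f ⟨S, hS, hL, rfl⟩
  omega

lemma StateFun.sum_apply {n : ℕ} {ι : Type*} (s : Finset ι) (f : ι → StateFun n)
    (x : ↥((Finset.Icc 1 n).powerset)) : (∑ i ∈ s, f i) x = ∑ i ∈ s, f i x :=
  Finset.sum_apply x s f

/-- The indicator function of the state `y`. -/
noncomputable def StateFun.single {n : ℕ} (y : ↥((Finset.Icc 1 n).powerset)) : StateFun n :=
  fun x => if x = y then 1 else 0

lemma StateFun.degreeLT_top (n : ℕ) : StateFun.degreeLT n (n + 1) = ⊤ := by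
  rw [eq_top_iff]
  intro f _
  have hind : ∀ y : ↥((Finset.Icc 1 n).powerset),
      (∑ R ∈ (Finset.Icc 1 n \ y.1).powerset, (-1 : ℝ) ^ R.card • StateFun.mono n (y.1 ∪ R)) =
        StateFun.single y := by
    intro y
    funext x
    rw [StateFun.sum_apply, StateFun.single]
    have h1 : ∀ R : Finset ℕ, ((-1 : ℝ) ^ R.card • StateFun.mono n (y.1 ∪ R)) x =
        (if y.1 ⊆ x.1 then 1 else 0) * ∏ i ∈ R, (if i ∈ x.1 then (-1 : ℝ) else 0) := by
      intro R
      change (-1 : ℝ) ^ R.card * (if y.1 ∪ R ⊆ x.1 then 1 else 0) = _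
      rw [Finset.prod_ite_zero, Finset.prod_const]
      by_cases h : y.1 ⊆ x.1
      · by_cases h' : R ⊆ x.1
        · rw [if_pos (Finset.union_subset h h'), if_pos h, if_pos fun i hi => h' hi]
          ring
        · rw [if_neg fun hR => h' (Finset.subset_union_right.trans hR),
            if_neg fun hR : ∀ i ∈ R, i ∈ x.1 => h' fun i hi => hR i hi]
          ring
      · rw [if_neg fun hR => h (Finset.subset_union_left.trans hR), if_neg h]
        ring
    simp only [h1]
    rw [← Finset.mul_sum, ← Finset.prod_one_add]
    by_cases hxy : x = y
    · subst hxy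
      rw [if_pos (Finset.Subset.refl _), if_pos rfl, one_mul]
      refine Finset.prod_eq_one fun i hi => ?_
      rw [if_neg (Finset.mem_sdiff.mp hi).2, add_zero]
    · rw [if_neg hxy]
      by_cases h : y.1 ⊆ x.1
      · have : ¬ x.1 ⊆ y.1 := fun h' => hxy (Subtype.ext (Finset.Subset.antisymm h' h))
        obtain ⟨i, hix, hiy⟩ := Finset.not_subset.mp this
        rw [Finset.prod_eq_zero (i := i)
          (Finset.mem_sdiff.mpr ⟨StateFun.subset x hix, hiy⟩) (by simp [hix]), mul_zero]
      · rw [if_neg h, zero_mul]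
  have hf : f = ∑ y, f y • StateFun.single y := by
    funext x
    rw [StateFun.sum_apply, Finset.sum_eq_single x]
    · change f x = f x * (if x = x then 1 else 0)
      simp
    · intro y _ hy
      change f y * (if x = y then 1 else 0) = 0
      rw [if_neg (Ne.symm hy), mul_zero]
    · simp
  rw [hf]
  refine Submodule.sum_mem _ fun y _ => Submodule.smul_mem _ _ ?_
  rw [← hind y]
  refine Submodule.sum_mem _ fun R hR => Submodule.smul_mem _ _ ?_
  have hS : y.1 ∪ R ⊆ Finset.Icc 1 n :=
    Finset.union_subset (StateFun.subset y)
      ((Finset.mem_powerset.mp hR).trans Finset.sdiff_subset)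
  refine StateFun.mono_mem_degreeLT hS ?_
  have := Finset.card_le_card hS
  simp only [Nat.card_Icc] at this
  omega

lemma StateFun.sub_smul_mem_degreeLT {n : ℕ} (T : StateFun n →ₗ[ℝ] StateFun n) (b : ℕ → ℝ)
    (c : Finset ℕ → Finset ℕ → ℝ)
    (hT : ∀ S ⊆ Finset.Icc 1 n,
      T (StateFun.mono n S) = ∑ R ∈ S.powerset, c S R • StateFun.mono n R)
    (hb : ∀ S, c S S = b S.card) (L : ℕ) (f : StateFun n)
    (hf : f ∈ StateFun.degreeLT n (L + 1)) : T f - b L • f ∈ StateFun.degreeLT n L := by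
  induction hf using Submodule.span_induction with
  | zero => simp
  | add f g _ _ hf hg =>
    rw [map_add, smul_add, add_sub_add_comm]
    exact Submodule.add_mem _ hf hg
  | smul a f _ hf =>
    rw [map_smul, smul_comm, ← smul_sub]
    exact Submodule.smul_mem _ _ hf
  | mem f hf =>
    obtain ⟨S, hS, hL, rfl⟩ := hf
    have hlower : ∀ R ∈ S.powerset, R ≠ S → StateFun.mono n R ∈ StateFun.degreeLT n L := by
      intro R hR hne
      have hRS := Finset.mem_powerset.mp hR
      have := Finset.card_lt_card (Finset.ssubset_iff_subset_ne.mpr ⟨hRS, hne⟩)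
      exact StateFun.mono_mem_degreeLT (hRS.trans hS) (by omega)
    rw [hT S hS, ← Finset.sum_erase_add _ _ (Finset.mem_powerset_self S), hb, add_sub_assoc,
      ← sub_smul]
    refine Submodule.add_mem _ (Submodule.sum_mem _ fun R hR => Submodule.smul_mem _ _ ?_) ?_
    · exact hlower R (Finset.mem_of_mem_erase hR) (Finset.ne_of_mem_erase hR)
    · rcases Nat.lt_succ_iff_lt_or_eq.mp hL with h | h
      · exact Submodule.smul_mem _ _ (StateFun.mono_mem_degreeLT hS h)
      · rw [h, sub_self, zero_smul]
        exact Submodule.zero_mem _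

/-- The Burnside transition operator. -/
noncomputable def StateFun.transition (n : ℕ) : StateFun n →ₗ[ℝ] StateFun n := KEndo n

lemma StateFun.transition_apply {n : ℕ} (f : StateFun n) (x : ↥((Finset.Icc 1 n).powerset)) :
    StateFun.transition n f x = ∑ y, Kmat n x.1 y.1 * f y := rfl

lemma StateFun.transition_mono {n : ℕ} {S : Finset ℕ} (hS : S ⊆ Finset.Icc 1 n) :
    StateFun.transition n (StateFun.mono n S) = ∑ R ∈ S.powerset,
      jointMoment (((X : ℝ[X]) ⊗ₜ[ℝ] (1 : ℝ[X]) - (1 : ℝ[X]) ⊗ₜ[ℝ] (X : ℝ[X])) ^ R.card *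
        ((1 : ℝ[X]) ⊗ₜ[ℝ] (X : ℝ[X])) ^ (S \ R).card) • StateFun.mono n R := by
  funext x
  set P := (X : ℝ[X]) ⊗ₜ[ℝ] (1 : ℝ[X])
  set Q := (1 : ℝ[X]) ⊗ₜ[ℝ] (X : ℝ[X])
  have h1 : StateFun.transition n (StateFun.mono n S) x =
      jointMoment (∏ i ∈ S, resampleVar x.1 i) := by
    rw [StateFun.transition_apply, ← sum_powerset_prod_mul_prod_sdiff _ hS, map_sum,
      ← Finset.sum_coe_sort (Finset.Icc 1 n).powerset]
    refine Finset.sum_congr rfl fun y _ => ?_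
    rw [Kmat_eq_jointMoment (StateFun.subset x) (StateFun.subset y)]
    by_cases h : S ⊆ y.1 <;> simp [StateFun.mono, h]
  have h2 : ∀ i, resampleVar x.1 i = (if i ∈ x.1 then P - Q else 0) + Q := by
    intro i
    unfold resampleVar
    split_ifs <;> simp [P, Q]
  rw [h1, StateFun.sum_apply]
  simp only [h2]
  rw [Finset.prod_add, map_sum]
  refine Finset.sum_congr rfl fun R _ => ?_
  change _ = jointMoment _ * (if R ⊆ x.1 then 1 else 0)
  rw [Finset.prod_ite_zero, Finset.prod_const, Finset.prod_const]
  by_cases h : R ⊆ x.1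
  · rw [if_pos h, if_pos (fun i hi => h hi), mul_one]
  · rw [if_neg h, if_neg (fun h' => h fun i hi => h' i hi), zero_mul, map_zero, mul_zero]

lemma StateFun.transition_sub_smul_mem {n L : ℕ} {f : StateFun n}
    (hf : f ∈ StateFun.degreeLT n (L + 1)) :
    StateFun.transition n f - degreeEigenvalue L • f ∈ StateFun.degreeLT n L :=
  StateFun.sub_smul_mem_degreeLT _ _ _ (fun _ hS => StateFun.transition_mono hS)
    (fun S => by simp [degreeEigenvalue]) L f hf

lemma StateFun.transition_isSymmetric (n : ℕ) : (StateFun.transition n).IsSymmetric := by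
  intro f g
  rw [StateFun.inner_eq, StateFun.inner_eq]
  simp only [StateFun.transition_apply, Finset.mul_sum, Finset.sum_mul]
  rw [Finset.sum_comm]
  refine Finset.sum_congr rfl fun x _ => Finset.sum_congr rfl fun y _ => ?_
  linear_combination f x * g y * piDist_mul_Kmat_comm (StateFun.subset y) (StateFun.subset x)

/-- The complement of a state. -/
def stateCompl {n : ℕ} (x : ↥((Finset.Icc 1 n).powerset)) : ↥((Finset.Icc 1 n).powerset) :=
  ⟨Finset.Icc 1 n \ x.1, Finset.mem_powerset.mpr Finset.sdiff_subset⟩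

lemma stateCompl_involutive (n : ℕ) : Function.Involutive (stateCompl (n := n)) := by
  intro x
  ext1
  simp [stateCompl, Finset.inter_eq_right.mpr (StateFun.subset x)]

lemma piDist_stateCompl {n : ℕ} (x : ↥((Finset.Icc 1 n).powerset)) :
    piDist n (stateCompl x).1 = piDist n x.1 := by
  have h : x.1.card ≤ n := by simpa using Finset.card_le_card (StateFun.subset x)
  simp only [piDist, stateCompl, Finset.card_sdiff_of_subset (StateFun.subset x), Nat.card_Icc,
    Nat.add_sub_cancel, Nat.choose_symm h]

/-- Composition with the complement map. -/
noncomputable def StateFun.flip (n : ℕ) : StateFun n →ₗ[ℝ] StateFun n where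
  toFun f x := f (stateCompl x)
  map_add' _ _ := rfl
  map_smul' _ _ := rfl

lemma StateFun.flip_apply {n : ℕ} (f : StateFun n) (x : ↥((Finset.Icc 1 n).powerset)) :
    StateFun.flip n f x = f (stateCompl x) := rfl

lemma StateFun.flip_mono {n : ℕ} {S : Finset ℕ} (hS : S ⊆ Finset.Icc 1 n) :
    StateFun.flip n (StateFun.mono n S) =
      ∑ R ∈ S.powerset, (-1 : ℝ) ^ R.card • StateFun.mono n R := by
  funext x
  rw [StateFun.sum_apply]
  have h1 : StateFun.flip n (StateFun.mono n S) x =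
      ∏ i ∈ S, (1 + if i ∈ x.1 then (-1 : ℝ) else 0) := by
    change (if S ⊆ Finset.Icc 1 n \ x.1 then (1 : ℝ) else 0) = _
    split_ifs with h
    · refine (Finset.prod_eq_one fun i hi => ?_).symm
      rw [if_neg (Finset.mem_sdiff.mp (h hi)).2, add_zero]
    · obtain ⟨i, hiS, hi⟩ := Finset.not_subset.mp h
      have hix : i ∈ x.1 := by
        by_contra hix
        exact hi (Finset.mem_sdiff.mpr ⟨hS hiS, hix⟩)
      rw [Finset.prod_eq_zero hiS (by simp [hix])]
  rw [h1, Finset.prod_one_add]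
  refine Finset.sum_congr rfl fun R _ => ?_
  change _ = (-1 : ℝ) ^ R.card * (if R ⊆ x.1 then 1 else 0)
  rw [Finset.prod_ite_zero, Finset.prod_const]
  by_cases h : R ⊆ x.1
  · rw [if_pos h, if_pos (fun i hi => h hi), mul_one]
  · rw [if_neg h, if_neg (fun h' => h fun i hi => h' i hi), mul_zero]

lemma StateFun.flip_sub_smul_mem {n L : ℕ} {f : StateFun n}
    (hf : f ∈ StateFun.degreeLT n (L + 1)) :
    StateFun.flip n f - (-1 : ℝ) ^ L • f ∈ StateFun.degreeLT n L :=
  StateFun.sub_smul_mem_degreeLT _ (fun L => (-1 : ℝ) ^ L) (fun _ R => (-1 : ℝ) ^ R.card)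
    (fun _ hS => StateFun.flip_mono hS) (fun _ => rfl) L f hf

lemma StateFun.flip_isSymmetric (n : ℕ) : (StateFun.flip n).IsSymmetric := by
  intro f g
  rw [StateFun.inner_eq, StateFun.inner_eq]
  refine Fintype.sum_equiv (stateCompl_involutive n).toPerm _ _ fun x => ?_
  simp only [StateFun.flip_apply, Function.Involutive.coe_toPerm, piDist_stateCompl,
    stateCompl_involutive n x]

section Filtration

variable {V : Type*} [NormedAddCommGroup V] [InnerProductSpace ℝ V] [FiniteDimensional ℝ V]

/-- The component of `v` in the orthogonal complement of `F L` in `F (L + 1)`. -/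
noncomputable def gradedPart (F : ℕ → Submodule ℝ V) (L : ℕ) (v : V) : V :=
  (F (L + 1)).starProjection v - (F L).starProjection v

variable {F : ℕ → Submodule ℝ V}

lemma gradedPart_mem (hF : Monotone F) (L : ℕ) (v : V) : gradedPart F L v ∈ F (L + 1) :=
  Submodule.sub_mem _ (Submodule.starProjection_apply_mem _ v)
    (hF L.le_succ (Submodule.starProjection_apply_mem _ v))

lemma inner_gradedPart_eq_zero (hF : Monotone F) {L : ℕ} (v : V) {u : V} (hu : u ∈ F L) :
    inner ℝ (gradedPart F L v) u = 0 := by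
  have h1 := Submodule.starProjection_inner_eq_zero (K := F L) v u hu
  have h2 := Submodule.starProjection_inner_eq_zero (K := F (L + 1)) v u (hF L.le_succ hu)
  rw [inner_sub_left] at h1 h2
  rw [gradedPart, inner_sub_left]
  linarith

lemma sum_gradedPart (h0 : F 0 = ⊥) (m : ℕ) (v : V) :
    ∑ L ∈ range m, gradedPart F L v = (F m).starProjection v := by
  have h : (F 0).starProjection v = 0 := by
    simp [h0]
  simp only [gradedPart]
  rw [Finset.sum_range_sub (fun L => (F L).starProjection v), h, sub_zero]

lemma norm_sq_sum_smul_gradedPart (hF : Monotone F) {φ : ℕ → ℕ} (hφ : StrictMono φ) (a : ℕ → ℝ)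
    (m : ℕ) (v : V) :
    ‖∑ k ∈ range m, a k • gradedPart F (φ k) v‖ ^ 2 =
      ∑ k ∈ range m, a k ^ 2 * ‖gradedPart F (φ k) v‖ ^ 2 := by
  induction m with
  | zero => simp
  | succ m ih =>
    have hmem : ∑ k ∈ range m, a k • gradedPart F (φ k) v ∈ F (φ m) :=
      Submodule.sum_mem _ fun k hk => Submodule.smul_mem _ _
        (hF (hφ (Finset.mem_range.mp hk)) (gradedPart_mem hF _ v))
    rw [Finset.sum_range_succ, Finset.sum_range_succ, norm_add_sq_real, ih, real_inner_smul_right,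
      real_inner_comm, inner_gradedPart_eq_zero hF v hmem, norm_smul, mul_pow, Real.norm_eq_abs,
      sq_abs]
    ring

lemma apply_gradedPart (hF : Monotone F) (h0 : F 0 = ⊥) {T : V →ₗ[ℝ] V} (hT : T.IsSymmetric)
    {b : ℕ → ℝ} (hb : ∀ L, ∀ u ∈ F (L + 1), T u - b L • u ∈ F L) (L : ℕ) (v : V) :
    T (gradedPart F L v) = b L • gradedPart F L v := by
  have hinv : ∀ u ∈ F L, T u ∈ F L := by
    intro u hu
    cases L with
    | zero =>
      rw [h0, Submodule.mem_bot] at hu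
      simp [hu]
    | succ k =>
      rw [← sub_add_cancel (T u) (b k • u)]
      exact Submodule.add_mem _ (hF k.le_succ (hb k u hu)) (Submodule.smul_mem _ _ hu)
  have hw := hb L _ (gradedPart_mem hF L v)
  rw [← sub_eq_zero, ← inner_self_eq_zero (𝕜 := ℝ)]
  set w := T (gradedPart F L v) - b L • gradedPart F L v with hwdef
  rw [hwdef, inner_sub_left, ← hwdef, hT, real_inner_smul_left,
    inner_gradedPart_eq_zero hF v hw, inner_gradedPart_eq_zero hF v (hinv w hw)]
  simp

lemma norm_sq_pow_apply (hF : Monotone F) (h0 : F 0 = ⊥) {m : ℕ} (hm : F m = ⊤) {T : V →ₗ[ℝ] V}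
    (hT : T.IsSymmetric) {b : ℕ → ℝ} (hb : ∀ L, ∀ u ∈ F (L + 1), T u - b L • u ∈ F L) (s : ℕ)
    (v : V) :
    ‖(T ^ s) v‖ ^ 2 = ∑ L ∈ range m, b L ^ (2 * s) * ‖gradedPart F L v‖ ^ 2 := by
  have h : (T ^ s) v = ∑ L ∈ range m, b L ^ s • gradedPart F L v := by
    have hv : v = ∑ L ∈ range m, gradedPart F L v := by
      rw [sum_gradedPart h0, hm, Submodule.starProjection_top]
      rfl
    conv_lhs => rw [hv]
    rw [map_sum]
    refine Finset.sum_congr rfl fun L _ => ?_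
    induction s with
    | zero => simp
    | succ s ih =>
      rw [pow_succ', Module.End.mul_apply, ih, map_smul, apply_gradedPart hF h0 hT hb, smul_smul,
        pow_succ]
  rw [h]
  simpa only [id, ← pow_mul, mul_comm s 2] using
    norm_sq_sum_smul_gradedPart hF strictMono_id (fun L => b L ^ s) m v

lemma inner_gradedPart_self (hF : Monotone F) (L : ℕ) (v : V) :
    inner ℝ (gradedPart F L v) v = ‖gradedPart F L v‖ ^ 2 := by
  have h2 := Submodule.starProjection_inner_eq_zero (K := F (L + 1)) v _ (gradedPart_mem hF L v)
  have h3 := inner_gradedPart_eq_zero hF v (Submodule.starProjection_apply_mem (F L) v)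
  rw [inner_sub_left, real_inner_comm] at h2
  rw [← real_inner_self_eq_norm_sq]
  conv_rhs => rw [gradedPart, inner_sub_right, ← gradedPart, h3]
  linarith [real_inner_comm ((F (L + 1)).starProjection v) (gradedPart F L v)]

end Filtration

/-- The probability, as a polynomial in the success parameter, that the random state whose
coordinate `n` is one and whose other coordinates are independent Bernoulli variables is `y`. -/
noncomputable def stateWeight (n : ℕ) (y : Finset ℕ) : ℝ[X] :=
  if n ∈ y then X ^ (y.card - 1) * (1 - X) ^ (n - y.card) else 0

lemma stateWeight_eq_prod {n : ℕ} (hn : 1 ≤ n) {y : Finset ℕ} (hy : y ⊆ Finset.Icc 1 n) :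
    stateWeight n y = (∏ i ∈ y, (if i = n then 1 else X : ℝ[X])) *
      ∏ i ∈ Finset.Icc 1 n \ y, (1 - (if i = n then 1 else X : ℝ[X])) := by
  unfold stateWeight
  split_ifs with h
  · congr 1
    · rw [← Finset.mul_prod_erase y _ h, if_pos rfl, one_mul, ← Finset.card_erase_of_mem h,
        ← Finset.prod_const]
      exact Finset.prod_congr rfl fun i hi => by rw [if_neg (Finset.ne_of_mem_erase hi)]
    · rw [show n - y.card = (Finset.Icc 1 n \ y).card by
        rw [Finset.card_sdiff_of_subset hy, Nat.card_Icc, Nat.add_sub_cancel], ← Finset.prod_const]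
      refine Finset.prod_congr rfl fun i hi => ?_
      rw [if_neg]
      rintro rfl
      exact (Finset.mem_sdiff.mp hi).2 h
  · rw [Finset.prod_eq_zero (s := Finset.Icc 1 n \ y) (i := n) _ (by simp), mul_zero]
    exact Finset.mem_sdiff.mpr ⟨Finset.mem_Icc.mpr ⟨hn, le_rfl⟩, h⟩

lemma unitIntegral_X_mul_stateWeight {n : ℕ} {y : Finset ℕ} (hy : y ⊆ Finset.Icc 1 n) :
    unitIntegral (X * stateWeight n y) = if n ∈ y then piDist n y else 0 := by
  unfold stateWeight
  split_ifs with h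
  · have h1 : 1 ≤ y.card := Finset.card_pos.mpr ⟨n, h⟩
    have h2 : y.card ≤ n := by simpa using Finset.card_le_card hy
    rw [← mul_assoc, ← pow_succ', Nat.sub_add_cancel h1, unitIntegral_beta, Nat.add_sub_cancel' h2,
      piDist]
  · rw [mul_zero, map_zero]

lemma eval_stateWeight_nonneg (n : ℕ) (y : Finset ℕ) {t : ℝ} (ht : t ∈ Set.Icc (0 : ℝ) 1) :
    0 ≤ (stateWeight n y).eval t := by
  have h0 := ht.1
  have h1 := sub_nonneg.mpr ht.2
  unfold stateWeight
  split_ifs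
  · simp only [eval_mul, eval_pow, eval_X, eval_sub, eval_one]
    positivity
  · simp

lemma eval_zero_stateWeight (n : ℕ) (y : Finset ℕ) :
    (stateWeight n y).eval 0 = if y = {n} then 1 else 0 := by
  unfold stateWeight
  by_cases hy : y = {n}
  · simp [hy]
  · rw [if_neg hy]
    split_ifs with h
    · have h1 : y.card ≠ 1 := by
        intro h1
        obtain ⟨a, rfl⟩ := Finset.card_eq_one.mp h1
        rw [Finset.mem_singleton.mp h] at hy
        exact hy rfl
      have h2 : y.card ≠ 0 := Finset.card_ne_zero_of_mem h
      simp [show y.card - 1 ≠ 0 by omega]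
    · simp

/-- The expectation of `h`, as a polynomial in the success parameter, at the random state whose
coordinate `n` is one and whose other coordinates are independent Bernoulli variables. -/
noncomputable def StateFun.expectation (n : ℕ) : StateFun n →ₗ[ℝ] ℝ[X] where
  toFun h := ∑ y, h y • stateWeight n y.1
  map_add' f g := by
    rw [← Finset.sum_add_distrib]
    exact Finset.sum_congr rfl fun y _ => add_smul (f y) (g y) _
  map_smul' c f := by
    rw [Finset.smul_sum]
    exact Finset.sum_congr rfl fun y _ => mul_smul c (f y) _

lemma StateFun.expectation_apply {n : ℕ} (h : StateFun n) :
    StateFun.expectation n h = ∑ y, h y • stateWeight n y.1 := rfl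

lemma StateFun.eval_expectation {n : ℕ} (h : StateFun n) (t : ℝ) :
    (StateFun.expectation n h).eval t = ∑ y, h y * (stateWeight n y.1).eval t := by
  simp [StateFun.expectation_apply, eval_finsetSum]

lemma StateFun.expectation_mono {n : ℕ} (hn : 1 ≤ n) {S : Finset ℕ} (hS : S ⊆ Finset.Icc 1 n) :
    StateFun.expectation n (StateFun.mono n S) = ∏ i ∈ S, (if i = n then 1 else X : ℝ[X]) := by
  rw [StateFun.expectation_apply, ← sum_powerset_prod_mul_prod_sdiff _ hS,
    ← Finset.sum_coe_sort (Finset.Icc 1 n).powerset]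
  refine Finset.sum_congr rfl fun y _ => ?_
  rw [← stateWeight_eq_prod hn (StateFun.subset y)]
  by_cases h : S ⊆ y.1 <;> simp [StateFun.mono, h]

lemma StateFun.natDegree_expectation_le {n L : ℕ} (hn : 1 ≤ n) {h : StateFun n}
    (hh : h ∈ StateFun.degreeLT n (L + 1)) : (StateFun.expectation n h).natDegree ≤ L := by
  induction hh using Submodule.span_induction with
  | zero => simp
  | add f g _ _ hf hg =>
    rw [map_add]
    exact natDegree_add_le_of_degree_le hf hg
  | smul a f _ hf =>
    rw [map_smul]
    exact (natDegree_smul_le a _).trans hf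
  | mem f hf =>
    obtain ⟨S, hS, hL, rfl⟩ := hf
    rw [StateFun.expectation_mono hn hS]
    refine (natDegree_prod_le _ _).trans ((Finset.sum_le_card_nsmul S _ 1 fun i _ => ?_).trans ?_)
    · split_ifs <;> simp
    · simpa using Nat.lt_succ_iff.mp hL

lemma sum_eval_stateWeight {n : ℕ} (hn : 1 ≤ n) (t : ℝ) :
    ∑ y : ↥((Finset.Icc 1 n).powerset), (stateWeight n y.1).eval t = 1 := by
  have h := StateFun.expectation_mono hn (Finset.empty_subset (Finset.Icc 1 n))
  rw [Finset.prod_empty] at h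
  rw [← eval_one (R := ℝ) (x := t), ← h, StateFun.eval_expectation]
  exact Finset.sum_congr rfl fun y _ => by simp [StateFun.mono]

lemma StateFun.unitIntegral_X_mul_expectation_sq_le {n : ℕ} (hn : 1 ≤ n) (h : StateFun n) :
    unitIntegral (X * StateFun.expectation n h ^ 2) ≤
      ∑ y, if n ∈ y.1 then h y ^ 2 * piDist n y.1 else 0 := by
  have h1 : unitIntegral (X * ∑ y, h y ^ 2 • stateWeight n y.1) =
      ∑ y, if n ∈ y.1 then h y ^ 2 * piDist n y.1 else 0 := by
    rw [Finset.mul_sum, map_sum]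
    refine Finset.sum_congr rfl fun y _ => ?_
    rw [mul_smul_comm, map_smul, unitIntegral_X_mul_stateWeight (StateFun.subset y), smul_eq_mul,
      mul_ite, mul_zero]
  rw [← h1]
  refine unitIntegral_mono fun t ht => ?_
  simp only [eval_mul, eval_X, eval_pow, StateFun.eval_expectation, eval_finsetSum, eval_smul,
    smul_eq_mul]
  refine mul_le_mul_of_nonneg_left ?_ ht.1
  have hw := fun y : ↥((Finset.Icc 1 n).powerset) => eval_stateWeight_nonneg n y.1 ht
  have hcs := Finset.sum_sq_le_sum_mul_sum_of_sq_le_mul Finset.univ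
    (r := fun y : ↥((Finset.Icc 1 n).powerset) => h y * (stateWeight n y.1).eval t)
    (f := fun y => h y ^ 2 * (stateWeight n y.1).eval t)
    (g := fun y => (stateWeight n y.1).eval t)
    (fun y _ => mul_nonneg (sq_nonneg _) (hw y)) (fun y _ => hw y) (fun y _ => le_of_eq (by ring))
  rwa [sum_eval_stateWeight hn, mul_one] at hcs

/-- The state `e_n`. -/
def lastState {n : ℕ} (hn : 1 ≤ n) : ↥((Finset.Icc 1 n).powerset) :=
  ⟨{n}, by simpa using hn⟩

lemma StateFun.eval_zero_expectation {n : ℕ} (hn : 1 ≤ n) (h : StateFun n) :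
    (StateFun.expectation n h).eval 0 = h (lastState hn) := by
  rw [StateFun.eval_expectation, Finset.sum_eq_single (lastState hn)]
  · simp [eval_zero_stateWeight, lastState]
  · intro y _ hy
    have hy' : y.1 ≠ {n} := fun h => hy (Subtype.ext h)
    rw [eval_zero_stateWeight, if_neg hy', mul_zero]
  · simp

lemma StateFun.sum_mem_sq_mul_piDist_eq {n : ℕ} (hn : 1 ≤ n) {h : StateFun n}
    (hflip : StateFun.flip n h = h) :
    ∑ y, (if n ∈ y.1 then h y ^ 2 * piDist n y.1 else 0) = ‖h‖ ^ 2 / 2 := by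
  have h1 : ∑ y, (if n ∈ y.1 then h y ^ 2 * piDist n y.1 else 0) =
      ∑ y, (if n ∈ y.1 then 0 else h y ^ 2 * piDist n y.1) := by
    refine Fintype.sum_equiv (stateCompl_involutive n).toPerm _ _ fun y => ?_
    have hc : h (stateCompl y) = h y := congrFun hflip y
    rw [Function.Involutive.coe_toPerm, piDist_stateCompl, hc]
    have : n ∈ (stateCompl y).1 ↔ n ∉ y.1 := by
      simp [stateCompl, hn]
    by_cases hy : n ∈ y.1 <;> simp [this, hy]
  have h2 : ∑ y, (if n ∈ y.1 then h y ^ 2 * piDist n y.1 else 0) +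
      ∑ y, (if n ∈ y.1 then 0 else h y ^ 2 * piDist n y.1) = ‖h‖ ^ 2 := by
    rw [StateFun.norm_sq_eq, ← Finset.sum_add_distrib]
    refine Finset.sum_congr rfl fun y _ => ?_
    split_ifs <;> ring
  linarith

lemma StateFun.apply_lastState_sq_le {n L : ℕ} (hn : 1 ≤ n) (hL : 1 ≤ L) {h : StateFun n}
    (hh : h ∈ StateFun.degreeLT n (L + 1)) (hflip : StateFun.flip n h = h) :
    h (lastState hn) ^ 2 ≤ ((L : ℝ) + 1) ^ 2 * ((L : ℝ) + 2) ^ 2 / 4 * ‖h‖ ^ 2 := by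
  have h1 := eval_zero_sq_le hL (StateFun.natDegree_expectation_le hn hh)
  have h2 := StateFun.unitIntegral_X_mul_expectation_sq_le hn h
  rw [StateFun.eval_zero_expectation hn] at h1
  rw [StateFun.sum_mem_sq_mul_piDist_eq hn hflip] at h2
  calc _ ≤ _ := h1
    _ ≤ ((L : ℝ) + 1) ^ 2 * ((L : ℝ) + 2) ^ 2 / 2 * (‖h‖ ^ 2 / 2) := by gcongr
    _ = _ := by ring

lemma sum_piDist (n : ℕ) : ∑ x ∈ (Finset.Icc 1 n).powerset, piDist n x = 1 := by
  unfold piDist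
  rw [Finset.sum_powerset_apply_card (fun j => 1 / (((n : ℝ) + 1) * (n.choose j))), Nat.card_Icc,
    Nat.add_sub_cancel]
  have h : ∀ j ∈ range (n + 1), n.choose j • (1 / (((n : ℝ) + 1) * (n.choose j))) =
      1 / ((n : ℝ) + 1) := by
    intro j hj
    have : (n.choose j : ℝ) ≠ 0 :=
      Nat.cast_ne_zero.mpr (Nat.choose_pos (Nat.lt_succ_iff.mp (Finset.mem_range.mp hj))).ne'
    rw [nsmul_eq_mul]
    field_simp
  rw [Finset.sum_congr rfl h, Finset.sum_const, Finset.card_range, nsmul_eq_mul]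
  push_cast
  field_simp

lemma StateFun.mono_empty_apply {n : ℕ} (x : ↥((Finset.Icc 1 n).powerset)) :
    StateFun.mono n ∅ x = 1 := by
  simp [StateFun.mono]

lemma StateFun.norm_mono_empty_sq (n : ℕ) : ‖StateFun.mono n ∅‖ ^ 2 = 1 := by
  rw [StateFun.norm_sq_eq, ← sum_piDist n,
    ← Finset.sum_coe_sort (Finset.Icc 1 n).powerset]
  exact Finset.sum_congr rfl fun x _ => by rw [StateFun.mono_empty_apply, one_pow, one_mul]

lemma StateFun.transition_mono_empty (n : ℕ) :
    StateFun.transition n (StateFun.mono n ∅) = StateFun.mono n ∅ := by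
  have h := StateFun.transition_sub_smul_mem
    (StateFun.mono_mem_degreeLT (n := n) (L := 0 + 1) (Finset.empty_subset _) (by simp))
  rw [StateFun.degreeLT_zero, Submodule.mem_bot, ← mul_zero 2, degreeEigenvalue_even] at h
  simpa [betaEV, sub_eq_zero] using h

lemma StateFun.inner_single {n : ℕ} (f : StateFun n) (x : ↥((Finset.Icc 1 n).powerset)) :
    inner ℝ f (StateFun.single x) = f x * piDist n x.1 := by
  rw [StateFun.inner_eq, Finset.sum_eq_single x]
  · simp [StateFun.single]
  · intro y _ hy
    simp [StateFun.single, hy]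
  · simp

lemma StateFun.transition_pow_single {n : ℕ} (s : ℕ) (x y : ↥((Finset.Icc 1 n).powerset)) :
    (StateFun.transition n ^ s) (StateFun.single y) x = Kpow n s x.1 y.1 := by
  induction s generalizing x with
  | zero =>
    change (if x = y then (1 : ℝ) else 0) = if x.1 = y.1 then 1 else 0
    by_cases h : x = y
    · rw [if_pos h, if_pos (congrArg Subtype.val h)]
    · rw [if_neg h, if_neg fun h' => h (Subtype.ext h')]
  | succ s ih =>
    rw [pow_succ', Module.End.mul_apply, StateFun.transition_apply]
    simp only [Kpow]
    rw [← Finset.sum_coe_sort (Finset.Icc 1 n).powerset]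
    exact Finset.sum_congr rfl fun z _ => by rw [ih]

lemma piDist_mul_Kpow_comm {n : ℕ} (s : ℕ) (x y : ↥((Finset.Icc 1 n).powerset)) :
    piDist n x.1 * Kpow n s x.1 y.1 = piDist n y.1 * Kpow n s y.1 x.1 := by
  have h := (StateFun.transition_isSymmetric n).pow s (StateFun.single y) (StateFun.single x)
  rw [StateFun.inner_single, real_inner_comm, StateFun.inner_single,
    StateFun.transition_pow_single, StateFun.transition_pow_single] at h
  linarith

/-- The density with respect to `π_n` of the point mass at `x`, minus one. -/
noncomputable def StateFun.centeredDensity {n : ℕ} (x : ↥((Finset.Icc 1 n).powerset)) :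
    StateFun n :=
  (piDist n x.1)⁻¹ • StateFun.single x - StateFun.mono n ∅

lemma StateFun.inner_centeredDensity {n : ℕ} (f : StateFun n)
    (x : ↥((Finset.Icc 1 n).powerset)) :
    inner ℝ f (StateFun.centeredDensity x) = f x - inner ℝ f (StateFun.mono n ∅) := by
  rw [StateFun.centeredDensity, inner_sub_right, real_inner_smul_right, StateFun.inner_single,
    mul_comm (f x), inv_mul_cancel_left₀ (piDist_pos (StateFun.subset x)).ne']

lemma StateFun.inner_centeredDensity_of_mem_degreeLT_one {n : ℕ} {f : StateFun n}
    (hf : f ∈ StateFun.degreeLT n 1) (x : ↥((Finset.Icc 1 n).powerset)) :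
    inner ℝ f (StateFun.centeredDensity x) = 0 := by
  induction hf using Submodule.span_induction with
  | zero => simp
  | add f g _ _ hf hg => rw [inner_add_left, hf, hg, add_zero]
  | smul a f _ hf => rw [real_inner_smul_left, hf, mul_zero]
  | mem f hf =>
    obtain ⟨S, -, hL, rfl⟩ := hf
    rw [Nat.lt_one_iff, Finset.card_eq_zero] at hL
    rw [hL, StateFun.inner_centeredDensity, real_inner_self_eq_norm_sq,
      StateFun.norm_mono_empty_sq, StateFun.mono_empty_apply, sub_self]

lemma chiSq_eq_norm_sq {n : ℕ} (s : ℕ) (x : ↥((Finset.Icc 1 n).powerset)) :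
    chiSq n s x.1 = ‖(StateFun.transition n ^ s) (StateFun.centeredDensity x)‖ ^ 2 := by
  have h1 : (StateFun.transition n ^ s) (StateFun.mono n ∅) = StateFun.mono n ∅ := by
    induction s with
    | zero => simp
    | succ s ih => rw [pow_succ, Module.End.mul_apply, StateFun.transition_mono_empty, ih]
  rw [StateFun.norm_sq_eq, chiSq, ← Finset.sum_coe_sort (Finset.Icc 1 n).powerset]
  refine Finset.sum_congr rfl fun y _ => ?_
  have h2 : (StateFun.transition n ^ s) (StateFun.centeredDensity x) y =
      (piDist n x.1)⁻¹ * Kpow n s y.1 x.1 - 1 := by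
    rw [StateFun.centeredDensity, map_sub, map_smul, h1, ← StateFun.transition_pow_single s y x,
      ← StateFun.mono_empty_apply y]
    rfl
  have hx := (piDist_pos (StateFun.subset x)).ne'
  have hy := (piDist_pos (StateFun.subset y)).ne'
  have h3 : Kpow n s x.1 y.1 = piDist n y.1 * ((piDist n x.1)⁻¹ * Kpow n s y.1 x.1) := by
    rw [mul_left_comm, ← piDist_mul_Kpow_comm, inv_mul_cancel_left₀ hx]
  rw [h2, h3]
  field_simp

lemma sum_range_two_mul {M : Type*} [AddCommMonoid M] (f : ℕ → M) (m : ℕ) :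
    ∑ i ∈ range (2 * m), f i = ∑ k ∈ range m, (f (2 * k) + f (2 * k + 1)) := by
  induction m with
  | zero => simp
  | succ m ih =>
    rw [show 2 * (m + 1) = 2 * m + 1 + 1 by ring, Finset.sum_range_succ, Finset.sum_range_succ, ih,
      Finset.sum_range_succ _ m, add_assoc]

/-- The squared norm of the degree `2 * (k + 1)` part of the centered density. -/
noncomputable def evenWeight {n : ℕ} (x : ↥((Finset.Icc 1 n).powerset)) (k : ℕ) : ℝ :=
  ‖gradedPart (StateFun.degreeLT n) (2 * (k + 1)) (StateFun.centeredDensity x)‖ ^ 2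

lemma chiSq_eq_sum {n s : ℕ} (hs : s ≠ 0) (x : ↥((Finset.Icc 1 n).powerset)) :
    chiSq n s x.1 = ∑ k ∈ range n, evenWeight x k * betaEV (k + 1) ^ (2 * s) := by
  have htop : StateFun.degreeLT n (2 * (n + 1)) = ⊤ :=
    top_le_iff.mp ((StateFun.degreeLT_top n).ge.trans (StateFun.degreeLT_mono n (by omega)))
  have hzero : gradedPart (StateFun.degreeLT n) 0 (StateFun.centeredDensity x) = 0 := by
    have h := inner_gradedPart_self (StateFun.degreeLT_mono n) 0 (StateFun.centeredDensity x)
    rw [StateFun.inner_centeredDensity_of_mem_degreeLT_one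
      (gradedPart_mem (StateFun.degreeLT_mono n) 0 _)] at h
    simpa using h.symm
  rw [chiSq_eq_norm_sq, norm_sq_pow_apply (StateFun.degreeLT_mono n) (StateFun.degreeLT_zero n) htop
    (StateFun.transition_isSymmetric n) (b := degreeEigenvalue)
    (fun L u hu => StateFun.transition_sub_smul_mem hu), sum_range_two_mul]
  simp only [degreeEigenvalue_even, degreeEigenvalue_odd]
  rw [Finset.sum_range_succ', mul_zero, hzero]
  simp [hs, evenWeight, mul_comm]

lemma sum_evenWeight_le {n : ℕ} (hn : 1 ≤ n) (M : ℕ) :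
    ∑ k ∈ range (M + 1), evenWeight (lastState hn) k ≤
      (2 * ((M : ℝ) + 1) + 1) ^ 2 * (((M : ℝ) + 1) + 1) ^ 2 := by
  have hF := StateFun.degreeLT_mono n
  set v := StateFun.centeredDensity (lastState hn)
  set h := ∑ k ∈ range (M + 1), gradedPart (StateFun.degreeLT n) (2 * (k + 1)) v with hdef
  have hmem : h ∈ StateFun.degreeLT n (2 * (M + 1) + 1) :=
    Submodule.sum_mem _ fun k hk =>
      hF (by have := Finset.mem_range.mp hk; omega) (gradedPart_mem hF _ v)
  have hflip : StateFun.flip n h = h := by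
    rw [hdef, map_sum]
    refine Finset.sum_congr rfl fun k _ => ?_
    rw [apply_gradedPart hF (StateFun.degreeLT_zero n) (StateFun.flip_isSymmetric n)
      (b := fun L => (-1 : ℝ) ^ L) (fun L u hu => StateFun.flip_sub_smul_mem hu)]
    simp
  have hnorm : ‖h‖ ^ 2 = ∑ k ∈ range (M + 1), evenWeight (lastState hn) k := by
    have hφ : StrictMono fun k => 2 * (k + 1) := fun a b hab => by dsimp only; omega
    simpa [evenWeight, hdef, v] using norm_sq_sum_smul_gradedPart hF hφ (fun _ => 1) (M + 1) v
  have hval : h (lastState hn) = ‖h‖ ^ 2 := by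
    have h1 : inner ℝ h v = ‖h‖ ^ 2 := by
      rw [hnorm, hdef, sum_inner]
      exact Finset.sum_congr rfl fun k _ => inner_gradedPart_self hF _ v
    have h2 : inner ℝ h (StateFun.mono n ∅) = 0 := by
      rw [hdef, sum_inner]
      refine Finset.sum_eq_zero fun k _ => inner_gradedPart_eq_zero hF v ?_
      exact StateFun.mono_mem_degreeLT (Finset.empty_subset _) (by simp)
    rw [← h1, StateFun.inner_centeredDensity, h2, sub_zero]
  have hle := StateFun.apply_lastState_sq_le hn (by omega) hmem hflip
  rw [hval] at hle
  rw [← hnorm]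
  push_cast at hle
  rcases (sq_nonneg ‖h‖).eq_or_lt with h0 | h0
  · rw [← h0]
    positivity
  · refine le_of_mul_le_mul_right ?_ h0
    linarith

lemma betaEV_nonneg (k : ℕ) : 0 ≤ betaEV k := by
  unfold betaEV
  positivity

lemma betaEV_succ (k : ℕ) :
    betaEV (k + 1) = betaEV k * ((2 * (k : ℝ) + 1) / (2 * (k : ℝ) + 2)) ^ 2 := by
  have h := Nat.succ_mul_centralBinom_succ k
  rw [← Nat.cast_inj (R := ℝ)] at h
  push_cast at h
  have hk : (k : ℝ) + 1 ≠ 0 := by positivity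
  have hk' : 2 * (k : ℝ) + 2 ≠ 0 := by positivity
  simp only [betaEV, ← Nat.centralBinom_eq_two_mul_choose]
  rw [← mul_left_cancel_iff_of_pos (by positivity : (0 : ℝ) < ((k : ℝ) + 1) ^ 2),
    ← mul_div_assoc, ← mul_pow, h]
  field_simp
  ring

lemma betaEV_antitone : Antitone betaEV := by
  refine antitone_nat_of_succ_le fun k => ?_
  rw [betaEV_succ]
  refine mul_le_of_le_one_right (betaEV_nonneg k) (pow_le_one₀ (by positivity) ?_)
  rw [div_le_one (by positivity)]
  linarith

lemma betaEV_le (k : ℕ) : betaEV k ≤ 1 / (2 * (k : ℝ) + 1) := by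
  induction k with
  | zero => simp [betaEV]
  | succ k ih =>
    rw [betaEV_succ]
    calc _ ≤ 1 / (2 * (k : ℝ) + 1) * ((2 * (k : ℝ) + 1) / (2 * (k : ℝ) + 2)) ^ 2 := by gcongr
      _ = (2 * (k : ℝ) + 1) / (2 * (k : ℝ) + 2) ^ 2 := by field_simp
      _ ≤ _ := by
        push_cast
        rw [div_le_div_iff₀ (by positivity) (by positivity)]
        nlinarith

lemma summable_betaEV_pow {s : ℕ} (hs : 3 ≤ s) :
    Summable (fun k : ℕ =>
      (32 * ((k : ℝ) + 1) ^ 3 + 16 * ((k : ℝ) + 1) ^ 2 + 6 * ((k : ℝ) + 1) + 1) *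
        betaEV (k + 1) ^ (2 * s)) := by
  have hsum : Summable fun k : ℕ => 55 * (1 / ((k + 1 : ℕ) : ℝ) ^ 3) :=
    ((summable_nat_add_iff 1).mpr (Real.summable_one_div_nat_pow.mpr (by norm_num))).mul_left 55
  refine Summable.of_nonneg_of_le (fun k => ?_) (fun k => ?_) hsum
  · have := betaEV_nonneg (k + 1)
    positivity
  · push_cast
    have hm : (1 : ℝ) ≤ (k : ℝ) + 1 := by linarith [(Nat.cast_nonneg k : (0 : ℝ) ≤ k)]
    have hb := betaEV_le (k + 1)
    push_cast at hb
    generalize (k : ℝ) + 1 = m at hm hb ⊢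
    have hm0 : 0 < m := by linarith
    have h1 : betaEV (k + 1) ^ (2 * s) ≤ (1 / m) ^ 6 := by
      have hb' : betaEV (k + 1) ≤ 1 / m :=
        hb.trans (one_div_le_one_div_of_le hm0 (by linarith))
      calc _ ≤ (1 / m) ^ (2 * s) := pow_le_pow_left₀ (betaEV_nonneg _) hb' _
        _ ≤ (1 / m) ^ 6 := pow_le_pow_of_le_one (by positivity)
            (by rw [div_le_one hm0]; exact hm) (by omega)
    have h2 : 32 * m ^ 3 + 16 * m ^ 2 + 6 * m + 1 ≤ 55 * m ^ 3 := by
      have : m ^ 2 ≤ m ^ 3 := pow_le_pow_right₀ hm (by norm_num)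
      nlinarith
    calc _ ≤ 55 * m ^ 3 * (1 / m) ^ 6 := by
          have := betaEV_nonneg (k + 1)
          gcongr
      _ = _ := by field_simp

lemma sum_mul_le_sum_mul_of_antitone {b c d : ℕ → ℝ} (hb : Antitone b) (hb0 : ∀ k, 0 ≤ b k)
    (h : ∀ M, ∑ k ∈ range M, c k ≤ ∑ k ∈ range M, d k) (M : ℕ) :
    ∑ k ∈ range M, c k * b k ≤ ∑ k ∈ range M, d k * b k := by
  have key : ∀ M, b M * (∑ k ∈ range M, d k - ∑ k ∈ range M, c k) ≤
      ∑ k ∈ range M, d k * b k - ∑ k ∈ range M, c k * b k := by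
    intro M
    induction M with
    | zero => simp
    | succ M ih =>
      have h1 := mul_le_mul_of_nonneg_right (hb M.le_succ) (sub_nonneg.mpr (h (M + 1)))
      simp only [Finset.sum_range_succ] at h1 ⊢
      rw [Nat.succ_eq_add_one] at h1
      linarith
  have h2 := mul_nonneg (hb0 M) (sub_nonneg.mpr (h M))
  linarith [key M]

lemma sq_mul_sq_le_sum_range (M : ℕ) :
    (2 * ((M : ℝ) + 1) + 1) ^ 2 * (((M : ℝ) + 1) + 1) ^ 2 ≤ ∑ k ∈ range (M + 1),
      (32 * ((k : ℝ) + 1) ^ 3 + 16 * ((k : ℝ) + 1) ^ 2 + 6 * ((k : ℝ) + 1) + 1) := by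
  induction M with
  | zero => norm_num
  | succ M ih =>
    rw [Finset.sum_range_succ]
    refine le_trans ?_ (add_le_add_left ih _)
    push_cast
    have hM : (0 : ℝ) ≤ M := Nat.cast_nonneg M
    rw [← sub_nonneg]
    ring_nf
    positivity

end BurnsideSpectralBound

/-- for n, s ≥ 3, χ²_{e_n}(s) ≤ Σ_{k≥1} (32k³+16k²+6k+1) β_k^{2s}, and the
series converges. -/
theorem chiSq_upper_bound_series (n s : ℕ) (hn : 3 ≤ n) (hs : 3 ≤ s) :
    Summable (fun k : ℕ =>
      (32 * ((k : ℝ) + 1) ^ 3 + 16 * ((k : ℝ) + 1) ^ 2 + 6 * ((k : ℝ) + 1) + 1) *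
        betaEV (k + 1) ^ (2 * s)) ∧
    chiSq n s {n} ≤
      ∑' k : ℕ,
        (32 * ((k : ℝ) + 1) ^ 3 + 16 * ((k : ℝ) + 1) ^ 2 + 6 * ((k : ℝ) + 1) + 1) *
          betaEV (k + 1) ^ (2 * s) := by
  have hn1 : 1 ≤ n := by omega
  have hsum := summable_betaEV_pow hs
  refine ⟨hsum, ?_⟩
  have hpartial : ∀ M, ∑ k ∈ range M, evenWeight (lastState hn1) k ≤ ∑ k ∈ range M,
      (32 * ((k : ℝ) + 1) ^ 3 + 16 * ((k : ℝ) + 1) ^ 2 + 6 * ((k : ℝ) + 1) + 1) := by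
    intro M
    cases M with
    | zero => simp
    | succ M => exact (sum_evenWeight_le hn1 M).trans (sq_mul_sq_le_sum_range M)
  have hanti : Antitone fun k => betaEV (k + 1) ^ (2 * s) := fun a b hab =>
    pow_le_pow_left₀ (betaEV_nonneg _) (betaEV_antitone (Nat.succ_le_succ hab)) _
  calc chiSq n s {n} = ∑ k ∈ range n, evenWeight (lastState hn1) k * betaEV (k + 1) ^ (2 * s) :=
        chiSq_eq_sum (by omega) (lastState hn1)
    _ ≤ _ := sum_mul_le_sum_mul_of_antitone hanti (fun k => pow_nonneg (betaEV_nonneg _) _)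
        hpartial n
    _ ≤ _ := hsum.sum_le_tsum _ fun k _ => by
        have := betaEV_nonneg (k + 1)
        positivity
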